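/- Let (c_{m,n})_{m,n∈ℕ^d} be a multisequence of complex numbers. Suppose there exists a family {μ_ξ}_{ξ∈Ξ} of positive Borel measures on ℂ^d such that c_{m,n}^ξ = ∫_{ℂ^d} z^m conj(z)^n dμ_ξ(z) for all m, n ∈ N_1 and all ξ ∈ Ξ, and such that μ_0 = 0 and μ_{ξ+η} + μ_{ξ−η} − 2μ_η ≥ 0 for all ξ, η ∈ Ξ. Then (c_{m,n}) is a complex moment multisequence: there exists a positive Borel measure ν on ℂ^d with c_{m,n} = ∫_{ℂ^d} z^m conj(z)^n dν(z) for all m, n ∈ ℕ^d. -/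

import Mathlib

open MeasureTheory Finsupp Complex

noncomputable section

/-- `z^m conj(z)^n` for `z ∈ ℂ^d`, `m, n ∈ ℕ^d`. -/
def cmom {d : ℕ} (z : Fin d → ℂ) (m n : Fin d → ℕ) : ℂ :=
  (∏ i, z i ^ m i) * ∏ i, (starRingEnd ℂ) (z i) ^ n i

/-- `c_{m,n}^ξ := ∑_{k,l} c_{m+k,n+l} ξ_k conj(ξ_l)`. -/
def cXi {d : ℕ} (c : (Fin d → ℕ) → (Fin d → ℕ) → ℂ) (ξ : (Fin d → ℕ) →₀ ℂ)
    (m n : Fin d → ℕ) : ℂ :=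
  ∑ k ∈ ξ.support, ∑ l ∈ ξ.support, c (m + k) (n + l) * ξ k * (starRingEnd ℂ) (ξ l)

section auxiliary

open Filter Topology
open scoped CompactlySupported

/-- A mean on the bounded functions of `G`: a normalized linear functional that is nonnegative on
bounded nonnegative functions (it takes arbitrary values on unbounded ones). -/
structure IsMean {G : Type*} (M : (G → ℝ) →ₗ[ℝ] ℝ) : Prop where
  nonneg : ∀ φ : G → ℝ, (∃ C, ∀ x, |φ x| ≤ C) → (∀ x, 0 ≤ φ x) → 0 ≤ M φ
  one : M (fun _ => 1) = 1

lemma IsMean.const {G : Type*} {M : (G → ℝ) →ₗ[ℝ] ℝ} (hM : IsMean M) (a : ℝ) :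
    M (fun _ => a) = a := by
  have : (fun _ : G => a) = a • (fun _ : G => (1 : ℝ)) := by ext; simp
  rw [this, map_smul, hM.one]; simp

lemma IsMean.abs_map_le {G : Type*} {M : (G → ℝ) →ₗ[ℝ] ℝ} (hM : IsMean M) {φ : G → ℝ} {C : ℝ}
    (h : ∀ x, |φ x| ≤ C) : |M φ| ≤ C := by
  have key : ∀ ψ : G → ℝ, (∀ x, |ψ x| ≤ C) → M ψ ≤ C := by
    intro ψ hψ
    have h1 : 0 ≤ M ((fun _ => C) - ψ) := by
      refine hM.nonneg _ ⟨C + C, fun x => ?_⟩ fun x => ?_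
      · have := abs_le.1 (hψ x)
        simp only [Pi.sub_apply]
        rw [abs_le]; constructor <;> linarith
      · have := abs_le.1 (hψ x)
        simp only [Pi.sub_apply]; linarith
    rw [map_sub, hM.const] at h1
    linarith
  rw [abs_le]
  have h2 := key (-φ) (by simpa using h)
  rw [map_neg] at h2
  exact ⟨by linarith, key φ h⟩

/-- The submodule of bounded real functions. -/
def boundedSubmodule (G : Type*) : Submodule ℝ (G → ℝ) where
  carrier := {φ | ∃ C, ∀ x, |φ x| ≤ C}
  add_mem' := by
    rintro φ ψ ⟨C, hC⟩ ⟨D, hD⟩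
    exact ⟨C + D, fun x => (abs_add_le _ _).trans (add_le_add (hC x) (hD x))⟩
  zero_mem' := ⟨0, fun x => by simp⟩
  smul_mem' := by
    rintro a φ ⟨C, hC⟩
    exact ⟨|a| * C, fun x => by
      simp only [Pi.smul_apply, smul_eq_mul, abs_mul]
      exact mul_le_mul_of_nonneg_left (hC x) (abs_nonneg a)⟩

lemma exists_mean_tendsto {G ι : Type*} (U : Ultrafilter ι) (m : ι → (G → ℝ) →ₗ[ℝ] ℝ)
    (hm : ∀ i, IsMean (m i)) :
    ∃ M : (G → ℝ) →ₗ[ℝ] ℝ, IsMean M ∧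
      ∀ φ : G → ℝ, (∃ C, ∀ x, |φ x| ≤ C) → Tendsto (fun i => m i φ) U (𝓝 (M φ)) := by
  have hex : ∀ φ : boundedSubmodule G, ∃ a, Tendsto (fun i => m i φ.1) U (𝓝 a) := by
    rintro ⟨φ, C, hC⟩
    have hc : IsCompact (Set.Icc (-C) C) := isCompact_Icc
    obtain ⟨a, -, ha⟩ := hc.ultrafilter_le_nhds (U.map fun i => m i φ) (by
      rw [le_principal_iff]
      exact Filter.mem_map.2 (univ_mem' fun i => abs_le.1 ((hm i).abs_map_le hC)))
    exact ⟨a, ha⟩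
  choose L hL using hex
  let L' : boundedSubmodule G →ₗ[ℝ] ℝ :=
    { toFun := L
      map_add' := fun φ ψ => tendsto_nhds_unique (hL (φ + ψ)) (by
        simpa using (hL φ).add (hL ψ))
      map_smul' := fun a φ => tendsto_nhds_unique (hL (a • φ)) (by
        simpa using (hL φ).const_mul a) }
  obtain ⟨M, hM⟩ := L'.exists_extend
  have hMt : ∀ φ : G → ℝ, (∃ C, ∀ x, |φ x| ≤ C) → Tendsto (fun i => m i φ) U (𝓝 (M φ)) := by
    intro φ hφ
    have : M φ = L ⟨φ, hφ⟩ := LinearMap.congr_fun hM ⟨φ, hφ⟩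
    rw [this]
    exact hL ⟨φ, hφ⟩
  refine ⟨M, ⟨fun φ hb h0 => ?_, ?_⟩, hMt⟩
  · exact ge_of_tendsto (hMt φ hb) (Eventually.of_forall fun i => (hm i).nonneg φ hb h0)
  · have h1 := hMt (fun _ => 1) ⟨1, fun _ => by simp⟩
    simp only [(hm _).one] at h1
    exact tendsto_nhds_unique h1 tendsto_const_nhds

/-- The operator averaging a function over the translates by `0, g, …, N • g`. -/
def translateAverage {G : Type*} [AddCommGroup G] (g : G) (N : ℕ) : (G → ℝ) →ₗ[ℝ] (G → ℝ) :=
  ((N : ℝ) + 1)⁻¹ • ∑ j ∈ Finset.range (N + 1), LinearMap.funLeft ℝ ℝ (fun x => x + j • g)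

lemma translateAverage_apply {G : Type*} [AddCommGroup G] (g : G) (N : ℕ) (φ : G → ℝ) (x : G) :
    translateAverage g N φ x
      = ((N : ℝ) + 1)⁻¹ * ∑ j ∈ Finset.range (N + 1), φ (x + j • g) := by
  simp [translateAverage, LinearMap.funLeft_apply]

lemma abs_translateAverage_le {G : Type*} [AddCommGroup G] (g : G) (N : ℕ) {φ : G → ℝ} {C : ℝ}
    (h : ∀ x, |φ x| ≤ C) (x : G) : |translateAverage g N φ x| ≤ C := by
  rw [translateAverage_apply, abs_mul, abs_of_pos (by positivity : (0:ℝ) < ((N : ℝ) + 1)⁻¹)]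
  have h1 : |∑ j ∈ Finset.range (N + 1), φ (x + j • g)| ≤ ((N : ℝ) + 1) * C := by
    refine (Finset.abs_sum_le_sum_abs _ _).trans ?_
    refine (Finset.sum_le_sum fun j _ => h _).trans ?_
    simp
  calc _ ≤ ((N : ℝ) + 1)⁻¹ * (((N : ℝ) + 1) * C) := by gcongr
    _ = C := by field_simp

lemma IsMean.comp_translateAverage {G : Type*} [AddCommGroup G] {M : (G → ℝ) →ₗ[ℝ] ℝ}
    (hM : IsMean M) (g : G) (N : ℕ) : IsMean (M ∘ₗ translateAverage g N) where
  nonneg φ hb h0 := by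
    obtain ⟨C, hC⟩ := hb
    refine hM.nonneg _ ⟨C, abs_translateAverage_le g N hC⟩ fun x => ?_
    rw [translateAverage_apply]
    exact mul_nonneg (by positivity) (Finset.sum_nonneg fun _ _ => h0 _)
  one := by
    have : translateAverage g N (fun _ => 1) = fun _ => 1 := by
      ext x
      rw [translateAverage_apply]
      simp
      field_simp
    rw [LinearMap.comp_apply, this, hM.one]

lemma exists_mean_invariant_finset {G : Type*} [AddCommGroup G] (F : Finset G) :
    ∃ M : (G → ℝ) →ₗ[ℝ] ℝ, IsMean M ∧ ∀ g ∈ F, ∀ φ : G → ℝ, (∃ C, ∀ x, |φ x| ≤ C) →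
      M (fun x => φ (x + g)) = M φ := by
  classical
  induction F using Finset.induction_on with
  | empty => exact ⟨LinearMap.proj 0, ⟨fun φ _ h => h 0, rfl⟩, by simp⟩
  | insert g F hg ih =>
    obtain ⟨M, hM, hinv⟩ := ih
    obtain ⟨M', hM', hlim⟩ := exists_mean_tendsto (Ultrafilter.of (atTop : Filter ℕ))
      (fun N => M ∘ₗ translateAverage g N) (fun N => hM.comp_translateAverage g N)
    refine ⟨M', hM', fun k hk φ hφ => ?_⟩
    have hφ' : ∃ C, ∀ x, |φ (x + k)| ≤ C := hφ.imp fun C hC x => hC _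
    have h1 := hlim _ hφ
    have h2 := hlim _ hφ'
    have hcase : k = g ∨ k ∈ F := Finset.mem_insert.1 hk
    rcases hcase with rfl | hkF
    · obtain ⟨C, hC⟩ := hφ
      have hz : Tendsto (fun N : ℕ => 2 * C / ((N : ℝ) + 1)) atTop (𝓝 0) := by
        simpa [div_eq_mul_inv] using
          (tendsto_one_div_add_atTop_nhds_zero_nat (𝕜 := ℝ)).const_mul (2 * C)
      have h3 := squeeze_zero_norm
        (f := fun N => (M ∘ₗ translateAverage k N) (fun x => φ (x + k))
          - (M ∘ₗ translateAverage k N) φ) (fun N => ?_) hz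
      · have h4 := (h2.sub h1)
        have h5 := tendsto_nhds_unique h4 (h3.mono_left (Ultrafilter.of_le _))
        linarith
      · rw [← map_sub, Real.norm_eq_abs, LinearMap.comp_apply]
        refine hM.abs_map_le fun x => ?_
        rw [map_sub, Pi.sub_apply, translateAverage_apply, translateAverage_apply, ← mul_sub,
          ← Finset.sum_sub_distrib]
        have h6 : ∀ j ∈ Finset.range (N + 1), φ (x + j • k + k) - φ (x + j • k)
            = (fun i : ℕ => φ (x + i • k)) (j + 1) - (fun i : ℕ => φ (x + i • k)) j := by
          intro j _
          simp [succ_nsmul, add_assoc]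
        rw [Finset.sum_congr rfl h6, Finset.sum_range_sub (fun i : ℕ => φ (x + i • k)), abs_mul,
          abs_of_pos (by positivity : (0:ℝ) < ((N : ℝ) + 1)⁻¹), div_eq_inv_mul]
        gcongr
        refine (abs_sub _ _).trans ?_
        linarith [hC (x + (N + 1) • k), hC (x + 0 • k)]
    · refine tendsto_nhds_unique h2 (h1.congr fun N => ?_)
      rw [LinearMap.comp_apply, LinearMap.comp_apply]
      obtain ⟨C, hC⟩ := hφ
      rw [← hinv k hkF _ ⟨C, abs_translateAverage_le g N hC⟩]
      congr 1
      ext x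
      simp only [translateAverage_apply, add_right_comm]

/-- Abelian groups are amenable. -/
lemma exists_mean_invariant (G : Type*) [AddCommGroup G] :
    ∃ M : (G → ℝ) →ₗ[ℝ] ℝ, IsMean M ∧ ∀ g, ∀ φ : G → ℝ, (∃ C, ∀ x, |φ x| ≤ C) →
      M (fun x => φ (x + g)) = M φ := by
  choose m hm hinv using fun F : Finset G => exists_mean_invariant_finset F
  obtain ⟨M, hM, hlim⟩ := exists_mean_tendsto (Ultrafilter.of (atTop : Filter (Finset G))) m hm
  refine ⟨M, hM, fun g φ hφ => ?_⟩
  have hφ' : ∃ C, ∀ x, |φ (x + g)| ≤ C := hφ.imp fun C hC x => hC _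
  refine tendsto_nhds_unique (hlim _ hφ') ((hlim _ hφ).congr' ?_)
  refine Ultrafilter.of_le _ ?_
  filter_upwards [eventually_ge_atTop ({g} : Finset G)] with F hF
  exact (hinv F g (hF (Finset.mem_singleton_self g)) φ hφ).symm

/-- Quadratic forms on the complex vector space `E`, as real functions obeying the parallelogram law
and invariant under multiplication by `I`. -/
def quadSubmodule (E : Type*) [AddCommGroup E] [Module ℂ E] : Submodule ℝ (E → ℝ) where
  carrier := {q | (∀ x y, q (x + y) + q (x - y) = 2 * q x + 2 * q y) ∧ ∀ x, q (I • x) = q x}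
  add_mem' := by
    rintro p q ⟨hp, hpI⟩ ⟨hq, hqI⟩
    refine ⟨fun x y => ?_, fun x => ?_⟩
    · simp only [Pi.add_apply]; linarith [hp x y, hq x y]
    · simp only [Pi.add_apply, hpI, hqI]
  zero_mem' := by simp
  smul_mem' := by
    rintro a p ⟨hp, hpI⟩
    refine ⟨fun x y => ?_, fun x => ?_⟩
    · simp only [Pi.smul_apply, smul_eq_mul]; linear_combination a * hp x y
    · simp only [Pi.smul_apply, hpI]

/-- Measurable functions dominated by a multiple of the weight `w`. -/
def domSubmodule {X : Type*} [MeasurableSpace X] (w : X → ℝ) : Submodule ℝ (X → ℝ) where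
  carrier := {h | Measurable h ∧ ∃ C, ∀ x, |h x| ≤ C * w x}
  add_mem' := by
    rintro f g ⟨hf, C, hC⟩ ⟨hg, D, hD⟩
    exact ⟨hf.add hg, C + D, fun x => by
      rw [add_mul]; exact (abs_add_le _ _).trans (add_le_add (hC x) (hD x))⟩
  zero_mem' := ⟨measurable_const, 0, fun x => by simp⟩
  smul_mem' := by
    rintro a f ⟨hf, C, hC⟩
    exact ⟨hf.const_smul a, |a| * C, fun x => by
      simp only [Pi.smul_apply, smul_eq_mul, abs_mul, mul_assoc]
      exact mul_le_mul_of_nonneg_left (hC x) (abs_nonneg a)⟩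

/-- Half the second difference of `x ↦ ∫ h ∂μ x` at `x` in the direction `y`. -/
def secondDiff {X E : Type*} [MeasurableSpace X] [AddCommGroup E] (μ : E → Measure X)
    (h : X → ℝ) (y x : E) : ℝ :=
  (∫ z, h z ∂μ (x + y) + ∫ z, h z ∂μ (x - y) - 2 * ∫ z, h z ∂μ x) / 2

section

variable {X E : Type*} [MeasurableSpace X] [AddCommGroup E] {μ : E → Measure X} {w : X → ℝ}

lemma integrable_of_mem_domSubmodule {ν : Measure X} (hw : Integrable w ν) {h : X → ℝ}
    (hh : h ∈ domSubmodule w) : Integrable h ν := by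
  obtain ⟨hm, C, hC⟩ := hh
  exact (hw.const_mul C).mono' hm.aestronglyMeasurable (Eventually.of_forall hC)

lemma secondDiff_nonneg [∀ x, IsFiniteMeasure (μ x)]
    (hpos : ∀ x y : E, ∀ s : Set X, MeasurableSet s → 2 * μ y s ≤ μ (x + y) s + μ (x - y) s)
    (hw : ∀ x, Integrable w (μ x)) {h : X → ℝ} (hh : h ∈ domSubmodule w) (hn : ∀ z, 0 ≤ h z)
    (y x : E) : 0 ≤ secondDiff μ h y x := by
  have hle : ∀ x, μ x ≤ μ (-x) := fun x => Measure.le_iff.2 fun s hs => by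
    have := hpos 0 x s hs
    rw [zero_add, zero_sub, two_mul] at this
    exact (ENNReal.add_le_add_iff_left (measure_ne_top _ _)).1 this
  have heven : μ (y - x) = μ (x - y) := by
    refine le_antisymm ?_ ?_
    · simpa using hle (y - x)
    · simpa using hle (x - y)
  have hm : μ x + μ x ≤ μ (x + y) + μ (x - y) := Measure.le_iff.2 fun s hs => by
    have := hpos y x s hs
    rw [two_mul, heven, add_comm y x] at this
    simpa using this
  have hi := fun x => integrable_of_mem_domSubmodule (hw x) hh
  have := integral_mono_measure hm (Eventually.of_forall hn)
    ((hi (x + y)).add_measure (hi (x - y)))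
  rw [integral_add_measure (hi _) (hi _), integral_add_measure (hi _) (hi _)] at this
  unfold secondDiff
  linarith

lemma secondDiff_add (hw : ∀ x, Integrable w (μ x)) {f g : X → ℝ} (hf : f ∈ domSubmodule w)
    (hg : g ∈ domSubmodule w) (y x : E) :
    secondDiff μ (f + g) y x = secondDiff μ f y x + secondDiff μ g y x := by
  have hi := fun x => integrable_of_mem_domSubmodule (hw x) hf
  have hj := fun x => integrable_of_mem_domSubmodule (hw x) hg
  unfold secondDiff
  simp only [Pi.add_apply]
  rw [integral_add (hi _) (hj _), integral_add (hi _) (hj _), integral_add (hi _) (hj _)]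
  ring

lemma secondDiff_smul (a : ℝ) (f : X → ℝ) (y x : E) :
    secondDiff μ (a • f) y x = a * secondDiff μ f y x := by
  unfold secondDiff
  simp only [Pi.smul_apply, smul_eq_mul, integral_const_mul]
  ring

lemma secondDiff_neg_dir (f : X → ℝ) (y x : E) :
    secondDiff μ f (-y) x = secondDiff μ f y x := by
  unfold secondDiff
  rw [← sub_eq_add_neg, sub_neg_eq_add]
  ring

lemma secondDiff_parallelogram (f : X → ℝ) (y y' x : E) :
    secondDiff μ f (y + y') x + secondDiff μ f (y - y') x
      = secondDiff μ f y' (x + y) + secondDiff μ f y' (x + -y) + 2 * secondDiff μ f y x := by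
  unfold secondDiff
  rw [show x + (y + y') = x + y + y' by abel, show x - (y + y') = x - y - y' by abel,
    show x + (y - y') = x + y - y' by abel, show x - (y - y') = x - y + y' by abel,
    ← sub_eq_add_neg]
  ring

variable [Module ℂ E]

lemma secondDiff_eq {f : X → ℝ} {q : E → ℝ} (hq : q ∈ quadSubmodule E)
    (hf : ∀ x, ∫ z, f z ∂μ x = q x) (y x : E) : secondDiff μ f y x = q y := by
  unfold secondDiff
  rw [hf, hf, hf]
  linarith [hq.1 x y]

lemma abs_secondDiff_le [∀ x, IsFiniteMeasure (μ x)]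
    (hpos : ∀ x y : E, ∀ s : Set X, MeasurableSet s → 2 * μ y s ≤ μ (x + y) s + μ (x - y) s)
    (hwm : Measurable w) (hw0 : ∀ z, 0 ≤ w z)
    (hw : ∀ x, Integrable w (μ x)) {q : E → ℝ} (hq : q ∈ quadSubmodule E)
    (hwq : ∀ x, ∫ z, w z ∂μ x = q x) {h : X → ℝ} (hh : h ∈ domSubmodule w) (y : E) :
    ∃ C, ∀ x, |secondDiff μ h y x| ≤ C := by
  obtain ⟨C, hC⟩ := hh.2
  have hwd : w ∈ domSubmodule w := ⟨hwm, 1, fun z => by rw [abs_of_nonneg (hw0 z), one_mul]⟩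
  refine ⟨C * q y, fun x => ?_⟩
  have h1 := secondDiff_nonneg hpos hw (h := C • w + h)
    (add_mem (Submodule.smul_mem _ _ hwd) hh)
    (fun z => by have := abs_le.1 (hC z); simp; linarith) y x
  have h2 := secondDiff_nonneg hpos hw (h := C • w + (-1 : ℝ) • h)
    (add_mem (Submodule.smul_mem _ _ hwd) (Submodule.smul_mem _ _ hh))
    (fun z => by have := abs_le.1 (hC z); simp; linarith) y x
  rw [secondDiff_add hw (Submodule.smul_mem _ _ hwd) hh, secondDiff_smul,
    secondDiff_eq hq hwq] at h1
  rw [secondDiff_add hw (Submodule.smul_mem _ _ hwd) (Submodule.smul_mem _ _ hh),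
    secondDiff_smul, secondDiff_smul, secondDiff_eq hq hwq] at h2
  rw [abs_le]
  constructor <;> linarith

/-- Averaging the second differences of a midpoint convex family of measures produces a positive
functional valued in quadratic forms, with the same quadratic moments as the family. -/
theorem exists_quadratic_average [∀ x, IsFiniteMeasure (μ x)]
    (hpos : ∀ x y : E, ∀ s : Set X, MeasurableSet s → 2 * μ y s ≤ μ (x + y) s + μ (x - y) s)
    (hwm : Measurable w) (hw0 : ∀ z, 0 ≤ w z)
    (hw : ∀ x, Integrable w (μ x)) {q : E → ℝ} (hq : q ∈ quadSubmodule E)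
    (hwq : ∀ x, ∫ z, w z ∂μ x = q x) :
    ∃ Q : (X → ℝ) →ₗ[ℝ] quadSubmodule E,
      (∀ h ∈ domSubmodule w, (∀ z, 0 ≤ h z) → ∀ x, 0 ≤ (Q h : E → ℝ) x) ∧
      ∀ h ∈ domSubmodule w, ∀ p ∈ quadSubmodule E, (∀ x, ∫ z, h z ∂μ x = p x) →
        (Q h : E → ℝ) = p := by
  obtain ⟨M, hM, hinv⟩ := exists_mean_invariant E
  have hb : ∀ h ∈ domSubmodule w, ∀ y : E, ∃ C, ∀ x, |secondDiff μ h y x| ≤ C :=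
    fun h hh y => abs_secondDiff_le hpos hwm hw0 hw hq hwq hh y
  have hpar : ∀ h ∈ domSubmodule w, ∀ y y' : E,
      M (secondDiff μ h (y + y')) + M (secondDiff μ h (y - y'))
        = 2 * M (secondDiff μ h y) + 2 * M (secondDiff μ h y') := by
    intro h hh y y'
    have h1 : secondDiff μ h (y + y') + secondDiff μ h (y - y')
        = (fun x => secondDiff μ h y' (x + y)) + (fun x => secondDiff μ h y' (x + -y))
          + (2 : ℝ) • secondDiff μ h y := by
      ext x
      exact secondDiff_parallelogram h y y' x
    rw [← map_add, h1, map_add, map_add, hinv _ _ (hb h hh y'), hinv _ _ (hb h hh y'), map_smul,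
      smul_eq_mul]
    ring
  have hneg : ∀ h, ∀ y : E, secondDiff μ h (-y) = secondDiff μ h y :=
    fun h y => funext fun x => secondDiff_neg_dir h y x
  let L : domSubmodule w →ₗ[ℝ] quadSubmodule E :=
    { toFun := fun h => ⟨fun y => (M (secondDiff μ h.1 y) + M (secondDiff μ h.1 (I • y))) / 2, by
        refine ⟨fun x y => ?_, fun x => ?_⟩
        · have h1 := hpar h.1 h.2 x y
          have h2 := hpar h.1 h.2 (I • x) (I • y)
          simp only [smul_add, smul_sub]
          linarith
        · simp only [smul_smul, I_mul_I, neg_one_smul, hneg, add_comm]⟩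
      map_add' := fun f g => by
        ext y
        have h1 : ∀ y, secondDiff μ (f.1 + g.1) y = secondDiff μ f.1 y + secondDiff μ g.1 y :=
          fun y => funext fun x => secondDiff_add hw f.2 g.2 y x
        simp only [Submodule.coe_add, h1, map_add, Pi.add_apply]
        ring
      map_smul' := fun a f => by
        ext y
        have h1 : ∀ y, secondDiff μ (a • f.1) y = a • secondDiff μ f.1 y :=
          fun y => funext fun x => secondDiff_smul a f.1 y x
        simp only [Submodule.coe_smul, h1, map_smul, Pi.smul_apply, RingHom.id_apply, smul_eq_mul]
        ring }
  obtain ⟨Q, hQ⟩ := L.exists_extend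
  have hQL : ∀ h (hh : h ∈ domSubmodule w), Q h = L ⟨h, hh⟩ :=
    fun h hh => LinearMap.congr_fun hQ ⟨h, hh⟩
  refine ⟨Q, fun h hh hn x => ?_, fun h hh p hp hintegral => ?_⟩
  · rw [hQL h hh]
    have h1 : ∀ y, 0 ≤ M (secondDiff μ h y) := fun y =>
      hM.nonneg _ (hb h hh y) fun x => secondDiff_nonneg hpos hw hh hn y x
    change 0 ≤ (M (secondDiff μ h x) + M (secondDiff μ h (I • x))) / 2
    linarith [h1 x, h1 (I • x)]
  · rw [hQL h hh]
    ext y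
    have h1 : ∀ y, M (secondDiff μ h y) = p y := fun y => by
      have : secondDiff μ h y = fun _ => p y := funext fun x => secondDiff_eq hp hintegral y x
      rw [this, hM.const]
    change (M (secondDiff μ h y) + M (secondDiff μ h (I • y))) / 2 = p y
    rw [h1, h1, hp.2]
    ring

end

section polarization

variable {E : Type*} [AddCommGroup E] [Module ℂ E]

lemma quadSubmodule.map_zero {q : E → ℝ} (hq : q ∈ quadSubmodule E) : q 0 = 0 := by
  have := hq.1 0 0
  simp only [add_zero, sub_zero] at this
  linarith

lemma quadSubmodule.map_neg {q : E → ℝ} (hq : q ∈ quadSubmodule E) (x : E) : q (-x) = q x := by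
  have := hq.1 0 x
  rw [zero_add, zero_sub, quadSubmodule.map_zero hq] at this
  linarith

lemma quadSubmodule.map_sub_comm {q : E → ℝ} (hq : q ∈ quadSubmodule E) (x y : E) :
    q (x - y) = q (y - x) := by
  rw [← neg_sub, quadSubmodule.map_neg hq]

lemma quadSubmodule.polar_add_left {q : E → ℝ} (hq : q ∈ quadSubmodule E) (a b y : E) :
    (q (a + b + y) - q (a + b - y)) / 4
      = (q (a + y) - q (a - y)) / 4 + (q (b + y) - q (b - y)) / 4 := by
  have key : ∀ x z, q (x + z + y) - q (x + z - y) + (q (x - z + y) - q (x - z - y))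
      = 2 * (q (x + y) - q (x - y)) := by
    intro x z
    have h1 := hq.1 (x + y) z
    have h2 := hq.1 (x - y) z
    rw [show x + y + z = x + z + y by abel, show x + y - z = x - z + y by abel] at h1
    rw [show x - y + z = x + z - y by abel, show x - y - z = x - z - y by abel] at h2
    linarith
  set c : E := (2⁻¹ : ℂ) • (a + b) with hc
  set e : E := (2⁻¹ : ℂ) • (a - b) with he
  have hcc : c + c = a + b := by rw [hc, ← add_smul]; norm_num
  have hca : c + e = a := by rw [hc, he, ← smul_add]; rw [show a + b + (a - b) = (2:ℂ) • a by
    rw [two_smul]; abel, smul_smul]; norm_num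
  have hcb : c - e = b := by rw [hc, he, ← smul_sub]; rw [show a + b - (a - b) = (2:ℂ) • b by
    rw [two_smul]; abel, smul_smul]; norm_num
  have h1 := key c e
  have h2 := key c c
  rw [hca, hcb] at h1
  rw [hcc, sub_self, zero_add, zero_sub, quadSubmodule.map_neg hq] at h2
  linarith

/-- The real symmetric biadditive form whose diagonal is a given element of `quadSubmodule`. -/
def polarForm : quadSubmodule E →ₗ[ℝ] (E →+ E →+ ℝ) where
  toFun q := AddMonoidHom.mk' (fun x => AddMonoidHom.mk' (fun y => (q.1 (x + y) - q.1 (x - y)) / 4)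
      (fun y y' => by
        have := quadSubmodule.polar_add_left q.2 y y' x
        rw [add_comm x, quadSubmodule.map_sub_comm q.2 x, add_comm x,
          quadSubmodule.map_sub_comm q.2 x, add_comm x, quadSubmodule.map_sub_comm q.2 x, this]))
    (fun x x' => by
      ext y
      exact quadSubmodule.polar_add_left q.2 x x' y)
  map_add' p q := by
    ext x y
    simp
    ring
  map_smul' a p := by
    ext x y
    simp
    ring

lemma polarForm_apply (q : quadSubmodule E) (x y : E) :
    polarForm q x y = (q.1 (x + y) - q.1 (x - y)) / 4 := rfl

lemma polarForm_self (q : quadSubmodule E) (x : E) : polarForm q x x = q.1 x := by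
  rw [polarForm_apply]
  have := q.2.1 x x
  rw [sub_self, quadSubmodule.map_zero q.2] at *
  linarith

end polarization

/-- A linear map from functions on `X` to symmetric, `I`-invariant biadditive forms, positive on the
nonnegative functions dominated by `w`. -/
structure IsPositiveForm {X E : Type*} [MeasurableSpace X] [AddCommGroup E] [Module ℂ E]
    (w : X → ℝ) (B : (X → ℝ) →ₗ[ℝ] (E →+ E →+ ℝ)) : Prop where
  symm : ∀ h x y, B h x y = B h y x
  smul_I : ∀ h x y, B h (I • x) (I • y) = B h x y
  nonneg : ∀ h ∈ domSubmodule w, (∀ z, 0 ≤ h z) → ∀ x, 0 ≤ B h x x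

section

variable {X E : Type*} [MeasurableSpace X] [AddCommGroup E] [Module ℂ E] {w : X → ℝ}

lemma isPositiveForm_polarForm (Q : (X → ℝ) →ₗ[ℝ] quadSubmodule E)
    (hQ : ∀ h ∈ domSubmodule w, (∀ z, 0 ≤ h z) → ∀ x, 0 ≤ (Q h : E → ℝ) x) :
    IsPositiveForm w (polarForm ∘ₗ Q) where
  symm h x y := by
    simp only [LinearMap.comp_apply, polarForm_apply]
    rw [add_comm, quadSubmodule.map_sub_comm (Q h).2]
  smul_I h x y := by
    simp only [LinearMap.comp_apply, polarForm_apply]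
    rw [← smul_add, ← smul_sub, (Q h).2.2, (Q h).2.2]
  nonneg h hh hn x := by
    rw [LinearMap.comp_apply, polarForm_self]
    exact hQ h hh hn x

/-- The real part of the sesquilinear form attached to a complex function. -/
def reForm (B : (X → ℝ) →ₗ[ℝ] (E →+ E →+ ℝ)) (h : X → ℂ) (x y : E) : ℝ :=
  B (fun z => (h z).re) x y + B (fun z => (h z).im) (I • x) y

namespace IsPositiveForm

variable {B : (X → ℝ) →ₗ[ℝ] (E →+ E →+ ℝ)}

lemma I_smul_left (hB : IsPositiveForm w B) (h : X → ℝ) (x y : E) :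
    B h (I • x) y = -B h x (I • y) := by
  have := hB.smul_I h (I • x) y
  rw [smul_smul, I_mul_I, neg_one_smul, map_neg, AddMonoidHom.neg_apply] at this
  linarith

lemma I_smul_self (hB : IsPositiveForm w B) (h : X → ℝ) (x : E) : B h (I • x) x = 0 := by
  have := hB.I_smul_left h x x
  rw [hB.symm h x] at this
  linarith

lemma reForm_conj (hB : IsPositiveForm w B) (h : X → ℂ) (x y : E) :
    reForm B (fun z => (starRingEnd ℂ) (h z)) x y = reForm B h y x := by
  simp only [reForm, conj_re, conj_im]
  rw [show (fun z => -(h z).im) = -(fun z => (h z).im) from rfl, map_neg, AddMonoidHom.neg_apply,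
    AddMonoidHom.neg_apply, hB.I_smul_left, hB.symm _ x y, hB.symm _ x (I • y)]
  ring

lemma abs_le (hB : IsPositiveForm w B) {h H : X → ℝ} (hh : h ∈ domSubmodule w)
    (hH : H ∈ domSubmodule w) (hle : ∀ z, |h z| ≤ H z) (x y : E) :
    |B h x y| ≤ (B H x x + B H y y) / 2 := by
  have h1 := fun x => hB.nonneg (H + h) (add_mem hH hh)
    (fun z => by have := _root_.abs_le.1 (hle z); simp only [Pi.add_apply]; linarith) x
  have h2 := fun x => hB.nonneg (H - h) (sub_mem hH hh)
    (fun z => by have := _root_.abs_le.1 (hle z); simp only [Pi.sub_apply]; linarith) x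
  have a1 := h1 (x + y)
  have a2 := h1 (x - y)
  have b1 := h2 (x + y)
  have b2 := h2 (x - y)
  simp only [map_add, map_sub, AddMonoidHom.add_apply, AddMonoidHom.sub_apply, hB.symm _ y x]
    at a1 a2 b1 b2
  rw [_root_.abs_le]
  constructor <;> linarith

lemma mono (hB : IsPositiveForm w B) {h H : X → ℝ} (hh : h ∈ domSubmodule w)
    (hH : H ∈ domSubmodule w) (hle : ∀ z, h z ≤ H z) (x : E) : B h x x ≤ B H x x := by
  have h2 := hB.nonneg (H - h) (sub_mem hH hh)
    (fun z => by have := hle z; simp only [Pi.sub_apply]; linarith) x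
  rw [map_sub, AddMonoidHom.sub_apply, AddMonoidHom.sub_apply] at h2
  linarith

/-- Positivity of `∫ f |(u + i v) x / n - y|²` for integer-valued `u`, `v` with finite range. -/
lemma lattice_nonneg (hB : IsPositiveForm w B) {f : X → ℝ} (hf : f ∈ domSubmodule w)
    (hf0 : ∀ z, 0 ≤ f z) {u v : X → ℤ} (hu : Measurable u) (hv : Measurable v) {K : ℤ}
    (huK : ∀ z, |u z| ≤ K) (hvK : ∀ z, |v z| ≤ K) {n : ℕ} (hn : 0 < n) (x y : E) :
    0 ≤ B (fun z => f z * ((u z / n) ^ 2 + (v z / n) ^ 2)) x x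
      - 2 * (B (fun z => f z * (u z / n)) x y + B (fun z => f z * (v z / n)) (I • x) y)
      + B f y y := by
  classical
  set S : Finset (ℤ × ℤ) := Finset.Icc (-K) K ×ˢ Finset.Icc (-K) K with hS
  set g : ℤ × ℤ → X → ℝ := fun p z => if (u z, v z) = p then f z else 0 with hg
  have hdec : ∀ a : ℤ × ℤ → ℝ, (fun z => f z * a (u z, v z)) = ∑ p ∈ S, a p • g p := by
    intro a
    ext z
    have hmem : (u z, v z) ∈ S := by
      rw [hS, Finset.mem_product, Finset.mem_Icc, Finset.mem_Icc]
      exact ⟨_root_.abs_le.1 (huK z), _root_.abs_le.1 (hvK z)⟩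
    rw [Finset.sum_apply]
    simp only [hg, Pi.smul_apply, smul_eq_mul, mul_ite, mul_zero]
    rw [Finset.sum_ite_eq, if_pos hmem, mul_comm]
  have hBdec : ∀ (a : ℤ × ℤ → ℝ) (x y : E),
      B (fun z => f z * a (u z, v z)) x y = ∑ p ∈ S, a p * B (g p) x y := by
    intro a x y
    rw [hdec a, map_sum, AddMonoidHom.finsetSum_apply, AddMonoidHom.finsetSum_apply]
    simp
  have hgd : ∀ p, g p ∈ domSubmodule w := by
    intro p
    obtain ⟨hm, C, hC⟩ := hf
    refine ⟨Measurable.ite ((hu.prodMk hv) (measurableSet_singleton p)) hm measurable_const, C,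
      fun z => ?_⟩
    refine le_trans ?_ (hC z)
    simp only [hg]
    split_ifs <;> simp
  have hg0 : ∀ p z, 0 ≤ g p z := by
    intro p z
    simp only [hg]
    split_ifs
    · exact hf0 z
    · exact le_rfl
  have e1 := hBdec (fun p => ((p.1 : ℝ) / n) ^ 2 + ((p.2 : ℝ) / n) ^ 2) x x
  have e2 := hBdec (fun p => (p.1 : ℝ) / n) x y
  have e3 := hBdec (fun p => (p.2 : ℝ) / n) (I • x) y
  have e4 := hBdec (fun _ => 1) y y
  simp only [mul_one, one_mul] at e4
  rw [e1, e2, e3, show B f y y = ∑ p ∈ S, B (g p) y y from e4, ← Finset.sum_add_distrib,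
    Finset.mul_sum, ← Finset.sum_sub_distrib, ← Finset.sum_add_distrib]
  refine Finset.sum_nonneg fun p _ => ?_
  have key := hB.nonneg (g p) (hgd p) (hg0 p) (p.1 • x + p.2 • (I • x) - (n : ℤ) • y)
  simp only [map_add, map_sub, map_zsmul, AddMonoidHom.add_apply, AddMonoidHom.sub_apply,
    AddMonoidHom.coe_smul, Pi.smul_apply, hB.smul_I, hB.I_smul_self, hB.symm _ y,
    hB.symm _ x (I • x), zsmul_eq_mul] at key
  have hn' : (0 : ℝ) < n := by exact_mod_cast hn
  have h2 := div_nonneg key (sq_nonneg (n : ℝ))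
  refine h2.trans_eq ?_
  push_cast
  field_simp
  ring

end IsPositiveForm
end

/-- Entrywise rounding down to `n⁻¹ ℤ`, truncated to `0` where the norm of `c` exceeds `n`. -/
def truncFloor (n : ℕ) (c : ℂ) (t : ℝ) : ℤ := if ‖c‖ ≤ n then ⌊n * t⌋ else 0

lemma abs_truncFloor_le (n : ℕ) {c : ℂ} {t : ℝ} (ht : |t| ≤ ‖c‖) :
    |truncFloor n c t| ≤ (n : ℤ) * n := by
  unfold truncFloor
  split_ifs with h
  · have h1 := abs_le.1 (ht.trans h)
    rw [abs_le]
    constructor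
    · rw [Int.le_floor]; push_cast; nlinarith
    · have : ((⌊n * t⌋ : ℤ) : ℝ) ≤ ((n * n : ℤ) : ℝ) := by
        refine (Int.floor_le _).trans ?_
        push_cast; nlinarith
      exact_mod_cast this
  · simp; positivity

lemma abs_sub_truncFloor_div_le {n : ℕ} (hn : 0 < n) {c : ℂ} {t W : ℝ} (ht : |t| ≤ ‖c‖)
    (h1 : 1 ≤ W) (hW : ‖c‖ ^ 2 ≤ W) : |t - truncFloor n c t / n| ≤ W / n := by
  have hn' : (0 : ℝ) < n := by exact_mod_cast hn
  unfold truncFloor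
  split_ifs with h
  · have h2 := Int.floor_le (n * t)
    have h3 := Int.lt_floor_add_one (n * t)
    rw [show t - (⌊n * t⌋ : ℤ) / (n : ℝ) = (n * t - ⌊n * t⌋) / n by field_simp, abs_div,
      abs_of_pos hn']
    gcongr
    rw [abs_le]
    constructor <;> linarith
  · push Not at h
    simp only [Int.cast_zero, zero_div, sub_zero]
    rw [le_div_iff₀ hn']
    nlinarith

lemma sq_truncFloor_div_le {n : ℕ} (hn : 0 < n) {c : ℂ} {t W : ℝ} (ht : |t| ≤ ‖c‖)
    (h1 : 1 ≤ W) (hW : ‖c‖ ^ 2 ≤ W) : (truncFloor n c t / n : ℝ) ^ 2 ≤ t ^ 2 + 3 * W / n := by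
  have hn' : (0 : ℝ) < n := by exact_mod_cast hn
  have hn1 : (1 : ℝ) ≤ n := by exact_mod_cast hn
  by_cases h : ‖c‖ ≤ n
  · have h2 := Int.floor_le (n * t)
    have h3 := Int.lt_floor_add_one (n * t)
    simp only [truncFloor, if_pos h]
    set e : ℝ := n * t - ⌊n * t⌋ with he
    have h4 : ((⌊n * t⌋ : ℤ) : ℝ) / n = t - e / n := by rw [he]; field_simp; ring
    rw [h4]
    have h5 : |t| ^ 2 ≤ ‖c‖ ^ 2 := by gcongr
    have h6 : (e / n) ^ 2 ≤ 1 / n := by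
      rw [div_pow, div_le_div_iff₀ (by positivity) hn']
      have : e ^ 2 ≤ 1 := by nlinarith
      nlinarith
    have h7 : -(2 * t * (e / n)) ≤ 2 * W / n := by
      rw [show -(2 * t * (e / n)) = 2 * (-t * e) / n by ring]
      have h8 : -t * e ≤ |t| := by
        nlinarith [neg_abs_le t, abs_nonneg t]
      have h9 : |t| ≤ W := by nlinarith [sq_nonneg (|t| - 1)]
      gcongr
      linarith
    have h10 : 1 / (n : ℝ) ≤ W / n := by gcongr
    have : 3 * W / n = 2 * W / n + W / n := by ring
    nlinarith
  · simp only [truncFloor, if_neg h]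
    simp
    positivity

section

variable {X E : Type*} [MeasurableSpace X] [AddCommGroup E] [Module ℂ E] {w : X → ℝ}

lemma mem_domSubmodule_of_abs_le {h H : X → ℝ} (hm : Measurable h) (hH : H ∈ domSubmodule w)
    (hle : ∀ z, |h z| ≤ H z) : h ∈ domSubmodule w :=
  ⟨hm, hH.2.imp fun _ hC z => (hle z).trans ((le_abs_self _).trans (hC z))⟩

namespace IsPositiveForm

variable {B : (X → ℝ) →ₗ[ℝ] (E →+ E →+ ℝ)}

/-- Positivity of `∫ f |φ x - y|²`. -/
lemma sq_nonneg (hB : IsPositiveForm w B) (hw : Measurable w) (hw1 : ∀ z, 1 ≤ w z) {φ : X → ℂ}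
    (hφ : Measurable φ) (hφw : ∀ z, ‖φ z‖ ^ 2 ≤ w z) {f : X → ℝ} (hf : Measurable f)
    (hf0 : ∀ z, 0 ≤ f z) {C : ℝ} (hfC : ∀ z, f z ≤ C) (x y : E) :
    0 ≤ B (fun z => f z * ‖φ z‖ ^ 2) x x - 2 * reForm B (fun z => f z * φ z) x y
      + B f y y := by
  have hH : (fun z => f z * w z) ∈ domSubmodule w := by
    refine ⟨hf.mul hw, C, fun z => ?_⟩
    have := hw1 z
    have := hf0 z
    have := hfC z
    rw [abs_of_nonneg (by positivity)]
    exact mul_le_mul_of_nonneg_right (hfC z) (by positivity)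
  have hfd : f ∈ domSubmodule w := mem_domSubmodule_of_abs_le hf hH fun z => by
    rw [abs_of_nonneg (hf0 z)]
    nlinarith [hw1 z, hf0 z]
  have hre : ∀ z, |(φ z).re| ≤ ‖φ z‖ := fun z => abs_re_le_norm _
  have him : ∀ z, |(φ z).im| ≤ ‖φ z‖ := fun z => abs_im_le_norm _
  set T := B (fun z => f z * w z) x x with hT
  set T' := B (fun z => f z * w z) y y with hT'
  have key : ∀ n : ℕ, 0 < n → -(8 * T + 2 * T') / n ≤
      B (fun z => f z * ‖φ z‖ ^ 2) x x - 2 * reForm B (fun z => f z * φ z) x y + B f y y := by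
    intro n hn
    have hn' : (0 : ℝ) < n := by exact_mod_cast hn
    set u : X → ℤ := fun z => truncFloor n (φ z) (φ z).re with hu
    set v : X → ℤ := fun z => truncFloor n (φ z) (φ z).im with hv
    have hset : MeasurableSet {z | ‖φ z‖ ≤ n} := measurableSet_le hφ.norm measurable_const
    have hum : Measurable u := Measurable.ite hset
      (Int.measurable_floor.comp ((measurable_re.comp hφ).const_mul _)) measurable_const
    have hvm : Measurable v := Measurable.ite hset
      (Int.measurable_floor.comp ((measurable_im.comp hφ).const_mul _)) measurable_const
    have hum' : Measurable fun z => (u z : ℝ) / n :=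
      ((measurable_of_countable (fun k : ℤ => (k : ℝ))).comp hum).div_const _
    have hvm' : Measurable fun z => (v z : ℝ) / n :=
      ((measurable_of_countable (fun k : ℤ => (k : ℝ))).comp hvm).div_const _
    have hlat := hB.lattice_nonneg hfd hf0 hum hvm (K := (n : ℤ) * n)
      (fun z => abs_truncFloor_le n (hre z)) (fun z => abs_truncFloor_le n (him z)) hn x y
    have hHn : ((n : ℝ)⁻¹ • fun z => f z * w z) ∈ domSubmodule w := Submodule.smul_mem _ _ hH
    have hbound : ∀ (t : X → ℝ), Measurable t → (∀ z, |t z| ≤ w z / n) → ∀ x,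
        |B (fun z => f z * t z) x y|
          ≤ (B (fun z => f z * w z) x x + B (fun z => f z * w z) y y) / (2 * n) := by
      intro t ht htw x
      have hle : ∀ z, |f z * t z| ≤ ((n : ℝ)⁻¹ • fun z => f z * w z) z := fun z => by
        rw [abs_mul, abs_of_nonneg (hf0 z)]
        simp only [Pi.smul_apply, smul_eq_mul]
        rw [show (n : ℝ)⁻¹ * (f z * w z) = f z * (w z / n) by ring]
        exact mul_le_mul_of_nonneg_left (htw z) (hf0 z)
      refine (hB.abs_le (mem_domSubmodule_of_abs_le (hf.mul ht) hHn hle) hHn hle x y).trans_eq ?_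
      simp only [map_smul, AddMonoidHom.smul_apply, smul_eq_mul]
      field_simp
    have b1 := hbound (fun z => (φ z).re - u z / n) ((measurable_re.comp hφ).sub hum')
      (fun z => abs_sub_truncFloor_div_le hn (hre z) (hw1 z) (hφw z)) x
    have b2 := hbound (fun z => (φ z).im - v z / n) ((measurable_im.comp hφ).sub hvm')
      (fun z => abs_sub_truncFloor_div_le hn (him z) (hw1 z) (hφw z)) (I • x)
    rw [hB.smul_I, ← hT, ← hT'] at b2
    rw [← hT, ← hT'] at b1
    have d0 : (fun z => f z * ‖φ z‖ ^ 2) ∈ domSubmodule w :=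
      mem_domSubmodule_of_abs_le (hf.mul (hφ.norm.pow_const 2)) hH fun z => by
        rw [abs_of_nonneg (mul_nonneg (hf0 z) (by positivity))]
        exact mul_le_mul_of_nonneg_left (hφw z) (hf0 z)
    have hsq : ∀ z, f z * ((u z / n : ℝ) ^ 2 + (v z / n) ^ 2)
        ≤ ((fun z => f z * ‖φ z‖ ^ 2) + (6 : ℝ) • (n : ℝ)⁻¹ • fun z => f z * w z) z := fun z => by
      have s1 := sq_truncFloor_div_le hn (hre z) (hw1 z) (hφw z)
      have s2 := sq_truncFloor_div_le hn (him z) (hw1 z) (hφw z)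
      have s3 : ‖φ z‖ ^ 2 = (φ z).re ^ 2 + (φ z).im ^ 2 := by
        rw [← normSq_eq_norm_sq, normSq_apply]; ring
      simp only [Pi.add_apply, Pi.smul_apply, smul_eq_mul]
      rw [show f z * ‖φ z‖ ^ 2 + 6 * ((n : ℝ)⁻¹ * (f z * w z))
        = f z * ((φ z).re ^ 2 + 3 * w z / n + ((φ z).im ^ 2 + 3 * w z / n)) by rw [s3]; ring]
      exact mul_le_mul_of_nonneg_left (add_le_add s1 s2) (hf0 z)
    have d1 := add_mem d0 (Submodule.smul_mem _ (6 : ℝ) hHn)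
    have d2 : (fun z => f z * ((u z / n : ℝ) ^ 2 + (v z / n) ^ 2)) ∈ domSubmodule w :=
      mem_domSubmodule_of_abs_le (hf.mul ((hum'.pow_const 2).add (hvm'.pow_const 2))) d1
        (fun z => by
          rw [abs_of_nonneg (mul_nonneg (hf0 z) (by positivity))]; exact hsq z)
    have b3 := hB.mono d2 d1 hsq x
    simp only [map_add, map_smul, AddMonoidHom.add_apply, AddMonoidHom.smul_apply, smul_eq_mul]
      at b3
    rw [← hT] at b3
    have r1 : reForm B (fun z => f z * φ z) x y
        = B (fun z => f z * (u z / n)) x y + B (fun z => f z * (v z / n)) (I • x) y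
          + B (fun z => f z * ((φ z).re - u z / n)) x y
          + B (fun z => f z * ((φ z).im - v z / n)) (I • x) y := by
      have e1 : (fun z => ((f z : ℂ) * φ z).re) = (fun z => f z * (u z / n : ℝ))
          + (fun z => f z * ((φ z).re - u z / n)) := by
        ext z; simp only [re_ofReal_mul, Pi.add_apply]; ring
      have e2 : (fun z => ((f z : ℂ) * φ z).im) = (fun z => f z * (v z / n : ℝ))
          + (fun z => f z * ((φ z).im - v z / n)) := by
        ext z; simp only [im_ofReal_mul, Pi.add_apply]; ring
      rw [reForm, e1, e2, map_add, map_add]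
      simp only [AddMonoidHom.add_apply]
      ring
    have c1 := (_root_.abs_le.1 b1).2
    have c2 := (_root_.abs_le.1 b2).2
    rw [r1]
    have e3 : -(8 * T + 2 * T') / n
      = -(6 * ((n : ℝ)⁻¹ * T)) - 2 * ((T + T') / (2 * n)) - 2 * ((T + T') / (2 * n)) := by
      field_simp; ring
    rw [e3]
    linarith
  have hlim : Tendsto (fun n : ℕ => -(8 * T + 2 * T') / (n : ℝ)) atTop (𝓝 0) :=
    tendsto_const_div_atTop_nhds_zero_nat _
  exact le_of_tendsto hlim ((eventually_gt_atTop 0).mono key)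

/-- Multiplication by `φ` acts as `S` as soon as the total square defect vanishes. -/
lemma reForm_mul_ofReal (hB : IsPositiveForm w B) (hw : Measurable w) (hw1 : ∀ z, 1 ≤ w z)
    {φ : X → ℂ} (hφ : Measurable φ) (hφw : ∀ z, ‖φ z‖ ^ 2 ≤ w z) {S : E → E}
    (hS : ∀ x, B (fun z => ‖φ z‖ ^ 2) x x - 2 * reForm B φ x (S x)
      + B (fun _ => 1) (S x) (S x) = 0) {f : X → ℝ} (hf : Measurable f)
    {C : ℝ} (hfC : ∀ z, |f z| ≤ C) (x y : E) :
    reForm B (fun z => f z * φ z) x y = B f (S x) y := by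
  have hadd : ∀ (f : X → ℝ) (x y : E), reForm B (fun z => f z * φ z) x y
      = B (fun z => f z * (φ z).re) x y + B (fun z => f z * (φ z).im) (I • x) y := by
    intro f x y
    simp only [reForm, re_ofReal_mul, im_ofReal_mul]
  have h01 : ∀ f : X → ℝ, Measurable f → (∀ z, 0 ≤ f z) → (∀ z, f z ≤ 1) →
      reForm B (fun z => f z * φ z) x y = B f (S x) y := by
    intro f hf hf0 hf1
    have n1 := hB.sq_nonneg hw hw1 hφ hφw hf hf0 hf1 x (S x)
    have n2 := hB.sq_nonneg hw hw1 hφ hφw (f := fun z => 1 - f z) (hf.const_sub 1)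
      (fun z => by linarith [hf1 z]) (C := 1) (fun z => by linarith [hf0 z]) x (S x)
    have n3 := hS x
    have e1 : (fun z => (1 - f z) * ‖φ z‖ ^ 2)
        = (fun z => ‖φ z‖ ^ 2) - fun z => f z * ‖φ z‖ ^ 2 := by
      ext z; simp only [Pi.sub_apply]; ring
    have e2 : (fun z => (1 - f z) * (φ z).re)
        = (fun z => (φ z).re) - fun z => f z * (φ z).re := by
      ext z; simp only [Pi.sub_apply]; ring
    have e3 : (fun z => (1 - f z) * (φ z).im)
        = (fun z => (φ z).im) - fun z => f z * (φ z).im := by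
      ext z; simp only [Pi.sub_apply]; ring
    have e4 : (fun z => 1 - f z) = (fun _ => 1) - f := rfl
    rw [hadd, e1, e2, e3, e4] at n2
    rw [reForm] at n3
    simp only [map_sub, AddMonoidHom.sub_apply] at n2
    have n4 : B (fun z => f z * ‖φ z‖ ^ 2) x x - 2 * reForm B (fun z => f z * φ z) x (S x)
        + B f (S x) (S x) = 0 := by
      refine le_antisymm ?_ n1
      rw [hadd]
      linarith
    have hquadratic : ∀ n : ℤ, 0 ≤ 2 * n * (B f (S x) y - reForm B (fun z => f z * φ z) x y)
        + B f y y := by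
      intro n
      have m1 := hB.sq_nonneg hw hw1 hφ hφw hf hf0 hf1 (n • x) (n • S x + y)
      rw [hadd] at m1 n4
      rw [hadd]
      rw [smul_comm I n x] at m1
      simp only [map_add, map_zsmul, AddMonoidHom.add_apply, AddMonoidHom.coe_smul, Pi.smul_apply,
        zsmul_eq_mul, hB.symm _ y] at m1
      have : (n : ℝ) ^ 2 * (B (fun z => f z * ‖φ z‖ ^ 2) x x
        - 2 * (B (fun z => f z * (φ z).re) x (S x) + B (fun z => f z * (φ z).im) (I • x) (S x))
        + B f (S x) (S x)) = 0 := by rw [n4, mul_zero]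
      linarith
    by_contra hne
    set D := B f (S x) y - reForm B (fun z => f z * φ z) x y with hD
    have hD0 : D ≠ 0 := fun h => hne (by linarith)
    obtain ⟨n, hn⟩ := exists_nat_gt (B f y y / (2 * |D|))
    have hDp : 0 < |D| := abs_pos.2 hD0
    rw [div_lt_iff₀ (by positivity)] at hn
    rcases abs_cases D with ⟨h1, h2⟩ | ⟨h1, h2⟩
    · have := hquadratic (-n)
      push_cast at this
      rw [h1] at hn
      linarith
    · have := hquadratic n
      push_cast at this
      rw [h1] at hn
      linarith
  set K : ℝ := |C| + 1 with hK
  have hK0 : 0 < K := by positivity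
  have hfK : ∀ z, |f z| ≤ K := fun z => (hfC z).trans ((le_abs_self C).trans (by linarith))
  have g1 := h01 (fun z => (f z + K) / (2 * K)) ((hf.add_const K).div_const _)
    (fun z => div_nonneg (by linarith [(_root_.abs_le.1 (hfK z)).1]) (by positivity))
    (fun z => by
      rw [div_le_one (by positivity)]; linarith [(_root_.abs_le.1 (hfK z)).2])
  have g2 := h01 (fun _ => 1) measurable_const (fun _ => zero_le_one) (fun _ => le_rfl)
  have e : ∀ t : X → ℝ, (fun z => f z * t z)
      = (2 * K) • (fun z => (f z + K) / (2 * K) * t z) - K • (fun z => 1 * t z) := by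
    intro t
    ext z
    simp only [Pi.sub_apply, Pi.smul_apply, smul_eq_mul]
    field_simp
    ring
  have e' : f = (2 * K) • (fun z => (f z + K) / (2 * K)) - K • (fun _ => 1) := by
    simpa using e (fun _ => 1)
  rw [hadd] at g1 g2 ⊢
  have e'' : B f (S x) y
      = B ((2 * K) • (fun z => (f z + K) / (2 * K)) - K • (fun _ => 1)) (S x) y := by
    rw [← e']
  rw [e (fun z => (φ z).re), e (fun z => (φ z).im), e'']
  simp only [map_sub, map_smul, AddMonoidHom.sub_apply, AddMonoidHom.smul_apply, smul_eq_mul]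
  linear_combination (2 * K) * g1 - K * g2

lemma reForm_mul (hB : IsPositiveForm w B) (hw : Measurable w) (hw1 : ∀ z, 1 ≤ w z)
    {φ : X → ℂ} (hφ : Measurable φ) (hφw : ∀ z, ‖φ z‖ ^ 2 ≤ w z) {S : E → E}
    (hSI : ∀ x, S (I • x) = I • S x)
    (hS : ∀ x, B (fun z => ‖φ z‖ ^ 2) x x - 2 * reForm B φ x (S x)
      + B (fun _ => 1) (S x) (S x) = 0) {f : X → ℂ} (hf : Measurable f)
    {C : ℝ} (hfC : ∀ z, ‖f z‖ ≤ C) (x y : E) :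
    reForm B (fun z => f z * φ z) x y = reForm B f (S x) y := by
  have h1 := hB.reForm_mul_ofReal hw hw1 hφ hφw hS (measurable_re.comp hf)
    (fun z => (abs_re_le_norm _).trans (hfC z)) x y
  have h2 := hB.reForm_mul_ofReal hw hw1 hφ hφw hS (measurable_im.comp hf)
    (fun z => (abs_im_le_norm _).trans (hfC z)) (I • x) y
  simp only [reForm, re_ofReal_mul, im_ofReal_mul, Function.comp_apply, smul_smul, I_mul_I,
    neg_one_smul, map_neg, AddMonoidHom.neg_apply, hSI] at h1 h2
  have e1 : (fun z => (f z * φ z).re)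
      = (fun z => (f z).re * (φ z).re) - fun z => (f z).im * (φ z).im := by
    ext z; simp
  have e2 : (fun z => (f z * φ z).im)
      = (fun z => (f z).re * (φ z).im) + fun z => (f z).im * (φ z).re := by
    ext z; simp
  simp only [reForm]
  rw [e1, e2, map_sub, map_add]
  simp only [AddMonoidHom.sub_apply, AddMonoidHom.add_apply]
  have h3 : B (fun z => (f z).re) (S x) y = B (re ∘ f) (S x) y := rfl
  have h4 : B (fun z => (f z).im) (I • S x) y = B (im ∘ f) (I • S x) y := rfl
  rw [h3, h4]
  linarith

end IsPositiveForm
end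

section sesquilinear

variable {d : ℕ} (c : (Fin d → ℕ) → (Fin d → ℕ) → ℂ)

/-- The sesquilinear form whose diagonal is `cXi`. -/
def sesq (m n : Fin d → ℕ) (ξ η : (Fin d → ℕ) →₀ ℂ) : ℂ :=
  ξ.sum fun k a => η.sum fun l b => c (m + k) (n + l) * a * (starRingEnd ℂ) b

lemma cXi_eq_sesq (ξ : (Fin d → ℕ) →₀ ℂ) (m n : Fin d → ℕ) : cXi c ξ m n = sesq c m n ξ ξ := rfl

variable {c} (m n : Fin d → ℕ)

lemma sesq_add_left (ξ ξ' η : (Fin d → ℕ) →₀ ℂ) :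
    sesq c m n (ξ + ξ') η = sesq c m n ξ η + sesq c m n ξ' η := by
  unfold sesq
  rw [Finsupp.sum_add_index']
  · simp
  · intro k a b
    rw [← Finsupp.sum_add]
    simp only [mul_add, add_mul]

lemma sesq_add_right (ξ η η' : (Fin d → ℕ) →₀ ℂ) :
    sesq c m n ξ (η + η') = sesq c m n ξ η + sesq c m n ξ η' := by
  unfold sesq
  rw [← Finsupp.sum_add]
  refine Finsupp.sum_congr fun k _ => ?_
  rw [Finsupp.sum_add_index']
  · simp
  · simp only [map_add, mul_add, implies_true]

lemma sesq_smul_left (a : ℂ) (ξ η : (Fin d → ℕ) →₀ ℂ) :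
    sesq c m n (a • ξ) η = a * sesq c m n ξ η := by
  unfold sesq
  rw [Finsupp.sum_smul_index' (by simp), Finsupp.mul_sum]
  refine Finsupp.sum_congr fun k _ => ?_
  rw [Finsupp.mul_sum]
  refine Finsupp.sum_congr fun l _ => ?_
  rw [smul_eq_mul]
  ring

lemma sesq_smul_right (a : ℂ) (ξ η : (Fin d → ℕ) →₀ ℂ) :
    sesq c m n ξ (a • η) = (starRingEnd ℂ) a * sesq c m n ξ η := by
  unfold sesq
  rw [Finsupp.mul_sum]
  refine Finsupp.sum_congr fun k _ => ?_
  rw [Finsupp.sum_smul_index' (by simp), Finsupp.mul_sum]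
  refine Finsupp.sum_congr fun l _ => ?_
  rw [smul_eq_mul, map_mul]
  ring

lemma sesq_sub_left (ξ ξ' η : (Fin d → ℕ) →₀ ℂ) :
    sesq c m n (ξ - ξ') η = sesq c m n ξ η - sesq c m n ξ' η := by
  rw [sub_eq_add_neg, ← neg_one_smul ℂ ξ', sesq_add_left, sesq_smul_left]
  ring

lemma sesq_sub_right (ξ η η' : (Fin d → ℕ) →₀ ℂ) :
    sesq c m n ξ (η - η') = sesq c m n ξ η - sesq c m n ξ η' := by
  rw [sub_eq_add_neg, ← neg_one_smul ℂ η', sesq_add_right, sesq_smul_right]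
  simp
  ring

/-- Translation of the index by `e`: the algebraic model of multiplication by `z ^ e`. -/
def shift (e : Fin d → ℕ) (ξ : (Fin d → ℕ) →₀ ℂ) : (Fin d → ℕ) →₀ ℂ :=
  Finsupp.mapDomain (fun k => e + k) ξ

lemma shift_smul (e : Fin d → ℕ) (a : ℂ) (ξ : (Fin d → ℕ) →₀ ℂ) :
    shift e (a • ξ) = a • shift e ξ := Finsupp.mapDomain_smul a ξ

lemma shift_zero (ξ : (Fin d → ℕ) →₀ ℂ) : shift 0 ξ = ξ := by
  unfold shift
  simp only [zero_add]
  exact Finsupp.mapDomain_id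

lemma shift_shift (e e' : Fin d → ℕ) (ξ : (Fin d → ℕ) →₀ ℂ) :
    shift e (shift e' ξ) = shift (e + e') ξ := by
  unfold shift
  rw [← Finsupp.mapDomain_comp]
  congr 1
  ext k
  simp [add_assoc]

lemma sesq_shift_left (e : Fin d → ℕ) (ξ η : (Fin d → ℕ) →₀ ℂ) :
    sesq c m n (shift e ξ) η = sesq c (m + e) n ξ η := by
  unfold sesq shift
  rw [Finsupp.sum_mapDomain_index]
  · simp only [add_assoc]
  · simp
  · intro k a b
    rw [← Finsupp.sum_add]
    simp only [mul_add, add_mul]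

lemma sesq_shift_right (e : Fin d → ℕ) (ξ η : (Fin d → ℕ) →₀ ℂ) :
    sesq c m n ξ (shift e η) = sesq c m (n + e) ξ η := by
  unfold sesq shift
  refine Finsupp.sum_congr fun k _ => ?_
  rw [Finsupp.sum_mapDomain_index]
  · simp only [add_assoc]
  · simp
  · simp only [map_add, mul_add, implies_true]

lemma sesq_single : sesq c m n (Finsupp.single 0 1) (Finsupp.single 0 1) = c m n := by
  simp [sesq]

lemma re_sesq_mem_quadSubmodule :
    (fun ξ => (sesq c m n ξ ξ).re) ∈ quadSubmodule ((Fin d → ℕ) →₀ ℂ) := by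
  refine ⟨fun x y => ?_, fun x => ?_⟩
  · simp only [sesq_add_left, sesq_add_right, sesq_sub_left, sesq_sub_right, add_re, sub_re]
    ring
  · simp [sesq_smul_left, sesq_smul_right]

lemma im_sesq_mem_quadSubmodule :
    (fun ξ => (sesq c m n ξ ξ).im) ∈ quadSubmodule ((Fin d → ℕ) →₀ ℂ) := by
  refine ⟨fun x y => ?_, fun x => ?_⟩
  · simp only [sesq_add_left, sesq_add_right, sesq_sub_left, sesq_sub_right, add_im, sub_im]
    ring
  · simp [sesq_smul_left, sesq_smul_right]

lemma polarForm_re_sesq {q : quadSubmodule ((Fin d → ℕ) →₀ ℂ)}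
    (hq : (q : ((Fin d → ℕ) →₀ ℂ) → ℝ) = fun ξ => (sesq c m n ξ ξ).re)
    (x y : (Fin d → ℕ) →₀ ℂ) :
    polarForm q x y = ((sesq c m n x y).re + (sesq c m n y x).re) / 2 := by
  rw [polarForm_apply, hq]
  simp only [sesq_add_left, sesq_add_right, sesq_sub_left, sesq_sub_right, add_re, sub_re]
  ring

lemma polarForm_im_sesq {q : quadSubmodule ((Fin d → ℕ) →₀ ℂ)}
    (hq : (q : ((Fin d → ℕ) →₀ ℂ) → ℝ) = fun ξ => (sesq c m n ξ ξ).im)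
    (x y : (Fin d → ℕ) →₀ ℂ) :
    polarForm q x y = ((sesq c m n x y).im + (sesq c m n y x).im) / 2 := by
  rw [polarForm_apply, hq]
  simp only [sesq_add_left, sesq_add_right, sesq_sub_left, sesq_sub_right, add_im, sub_im]
  ring

lemma sesq_re_comm (h : ∀ ξ, (sesq c m n ξ ξ).im = 0) (x y : (Fin d → ℕ) →₀ ℂ) :
    (sesq c m n y x).re = (sesq c m n x y).re := by
  have h1 := h (I • x + y)
  simp only [sesq_add_left, sesq_add_right, sesq_smul_left, sesq_smul_right, add_im, h] at h1
  simp [h] at h1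
  linarith

end sesquilinear

section monomials

variable {d : ℕ}

lemma cmom_zero_zero (z : Fin d → ℂ) : cmom z 0 0 = 1 := by simp [cmom]

lemma prod_pow_single (z : Fin d → ℂ) (i : Fin d) :
    ∏ j, z j ^ (Pi.single i 1 : Fin d → ℕ) j = z i := by
  rw [Finset.prod_eq_single i]
  · simp
  · intro j _ hj
    simp [hj]
  · simp

lemma cmom_single_zero (z : Fin d → ℂ) (i : Fin d) : cmom z (Pi.single i 1) 0 = z i := by
  simp [cmom, prod_pow_single]

lemma cmom_self (z : Fin d → ℂ) (m : Fin d → ℕ) :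
    cmom z m m = ((‖∏ j, z j ^ m j‖ ^ 2 : ℝ) : ℂ) := by
  rw [cmom]
  simp only [← map_pow, ← map_prod]
  rw [mul_conj, normSq_eq_norm_sq]

lemma cmom_single_single (z : Fin d → ℂ) (i : Fin d) :
    cmom z (Pi.single i 1) (Pi.single i 1) = ((‖z i‖ ^ 2 : ℝ) : ℂ) := by
  rw [cmom_self, prod_pow_single]

lemma norm_cmom_le (z : Fin d → ℂ) (m n : Fin d → ℕ) :
    ‖cmom z m n‖ ≤ ‖cmom z m m‖ + ‖cmom z n n‖ := by
  rw [cmom_self, cmom_self, norm_real, norm_real, norm_pow, norm_pow, norm_norm, norm_norm, cmom]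
  simp only [← map_pow, ← map_prod]
  rw [norm_mul, RCLike.norm_conj]
  nlinarith [sq_nonneg (‖∏ j, z j ^ m j‖ - ‖∏ j, z j ^ n j‖), norm_nonneg (∏ j, z j ^ m j),
    norm_nonneg (∏ j, z j ^ n j)]

lemma continuous_cmom (m n : Fin d → ℕ) : Continuous fun z : Fin d → ℂ => cmom z m n := by
  unfold cmom
  fun_prop

/-- The weight `1 + |z|²`. -/
def momentWeight (z : Fin d → ℂ) : ℝ := 1 + ∑ i, ‖z i‖ ^ 2

lemma one_le_momentWeight (z : Fin d → ℂ) : 1 ≤ momentWeight z := by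
  have : 0 ≤ ∑ i, ‖z i‖ ^ 2 := Finset.sum_nonneg fun _ _ => by positivity
  unfold momentWeight
  linarith

lemma sq_norm_apply_le_momentWeight (i : Fin d) (z : Fin d → ℂ) : ‖z i‖ ^ 2 ≤ momentWeight z := by
  have := Finset.single_le_sum (f := fun i => ‖z i‖ ^ 2) (fun _ _ => by positivity)
    (Finset.mem_univ i)
  unfold momentWeight
  linarith

lemma sq_norm_le_momentWeight (z : Fin d → ℂ) : ‖z‖ ^ 2 ≤ momentWeight z := by
  have h0 : 0 ≤ momentWeight z := zero_le_one.trans (one_le_momentWeight z)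
  have : ‖z‖ ≤ √(momentWeight z) := (pi_norm_le_iff_of_nonneg (Real.sqrt_nonneg _)).2 fun i =>
    Real.le_sqrt_of_sq_le (sq_norm_apply_le_momentWeight i z)
  calc ‖z‖ ^ 2 ≤ √(momentWeight z) ^ 2 := by gcongr
    _ = momentWeight z := Real.sq_sqrt h0

lemma continuous_momentWeight : Continuous (momentWeight : (Fin d → ℂ) → ℝ) := by
  unfold momentWeight
  fun_prop

variable {E : Type*} [AddCommGroup E] [Module ℂ E]

/-- If multiplication by each coordinate acts as `T (Pi.single i 1)`, then multiplication by `z ^ m`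
acts as `T m` on compactly supported functions. -/
lemma reForm_mul_monomial {B : ((Fin d → ℂ) → ℝ) →ₗ[ℝ] (E →+ E →+ ℝ)} {T : (Fin d → ℕ) → E → E}
    (hT0 : ∀ x, T 0 x = x) (hT : ∀ e e' x, T e (T e' x) = T (e + e') x)
    (hmul : ∀ i, ∀ f : (Fin d → ℂ) → ℂ, Measurable f → (∃ C, ∀ z, ‖f z‖ ≤ C) → ∀ x y,
      reForm B (fun z => f z * z i) x y = reForm B f (T (Pi.single i 1) x) y)
    (m : Fin d → ℕ) {f : (Fin d → ℂ) → ℂ} (hf : Measurable f) {R C : ℝ} (hC : ∀ z, ‖f z‖ ≤ C)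
    (hR : ∀ z, R < ‖z‖ → f z = 0) (x y : E) :
    reForm B (fun z => f z * ∏ i, z i ^ m i) x y = reForm B f (T m x) y := by
  induction hk : ∑ i, m i generalizing m f C x with
  | zero =>
    have hm : m = 0 := by
      ext i
      exact (Finset.sum_eq_zero_iff.1 hk) i (Finset.mem_univ i)
    subst hm
    simp [hT0]
  | succ k ih =>
    obtain ⟨i, hi⟩ : ∃ i, m i ≠ 0 := by
      by_contra! h
      simp [h] at hk
    obtain ⟨p, rfl⟩ : ∃ p : Fin d → ℕ, m = Pi.single i 1 + p := by
      refine ⟨m - Pi.single i 1, ?_⟩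
      ext j
      by_cases hj : j = i
      · subst hj
        simp
        omega
      · simp [hj]
    have hp : ∑ j, p j = k := by
      simp only [Pi.add_apply, Finset.sum_add_distrib, Finset.sum_pi_single', Finset.mem_univ,
        if_true] at hk
      omega
    have hprod : (fun z : Fin d → ℂ => f z * ∏ j, z j ^ (Pi.single i 1 + p : Fin d → ℕ) j)
        = fun z => (f z * z i) * ∏ j, z j ^ p j := by
      ext z
      simp only [Pi.add_apply, pow_add, Finset.prod_mul_distrib]
      rw [prod_pow_single, mul_assoc]
    have hC0 : 0 ≤ C := (norm_nonneg _).trans (hC 0)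
    rw [hprod, ih p (f := fun z => f z * z i) (hf.mul (measurable_pi_apply i))
      (C := C * |R|) (fun z => ?_) (fun z hz => ?_) x hp, hmul i f hf ⟨C, hC⟩, hT]
    · rw [norm_mul]
      by_cases hz : R < ‖z‖
      · rw [hR z hz, norm_zero, zero_mul]
        positivity
      · push Not at hz
        gcongr
        · exact hC z
        · exact (norm_le_pi_norm z i).trans (hz.trans (le_abs_self R))
    · rw [hR z hz, zero_mul]

lemma IsPositiveForm.reForm_mul_cmom {w : (Fin d → ℂ) → ℝ}
    {B : ((Fin d → ℂ) → ℝ) →ₗ[ℝ] (E →+ E →+ ℝ)} (hB : IsPositiveForm w B)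
    {T : (Fin d → ℕ) → E → E}
    (hT0 : ∀ x, T 0 x = x) (hT : ∀ e e' x, T e (T e' x) = T (e + e') x)
    (hmul : ∀ i, ∀ f : (Fin d → ℂ) → ℂ, Measurable f → (∃ C, ∀ z, ‖f z‖ ≤ C) → ∀ x y,
      reForm B (fun z => f z * z i) x y = reForm B f (T (Pi.single i 1) x) y)
    (m n : Fin d → ℕ) {f : (Fin d → ℂ) → ℂ} (hf : Continuous f) (hfc : HasCompactSupport f)
    (x y : E) :
    reForm B (fun z => f z * cmom z m n) x y = reForm B f (T m x) (T n y) := by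
  have hdec : ∀ g : (Fin d → ℂ) → ℂ, Continuous g → HasCompactSupport g →
      ∃ R C : ℝ, (∀ z, ‖g z‖ ≤ C) ∧ ∀ z, R < ‖z‖ → g z = 0 := by
    intro g hg hgc
    obtain ⟨C, hC⟩ := hgc.exists_bound_of_continuous hg
    obtain ⟨R, hR⟩ := hgc.isCompact.isBounded.subset_closedBall 0
    refine ⟨R, C, hC, fun z hz => ?_⟩
    by_contra hne
    have := hR (subset_tsupport g hne)
    rw [mem_closedBall_zero_iff] at this
    linarith
  have hg : Continuous fun z : Fin d → ℂ => f z * (starRingEnd ℂ) (∏ i, z i ^ n i) := by fun_prop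
  have hgc : HasCompactSupport fun z : Fin d → ℂ => f z * (starRingEnd ℂ) (∏ i, z i ^ n i) :=
    hfc.mul_right
  obtain ⟨R, C, hC, hR⟩ := hdec _ hg hgc
  obtain ⟨R', C', hC', hR'⟩ := hdec f hf hfc
  have e1 : (fun z => f z * cmom z m n)
      = fun z => (f z * (starRingEnd ℂ) (∏ i, z i ^ n i)) * ∏ i, z i ^ m i := by
    ext z
    simp only [cmom, map_prod, map_pow]
    ring
  rw [e1, reForm_mul_monomial hT0 hT hmul m hg.measurable hC hR, ← hB.reForm_conj]
  simp only [map_mul, conj_conj]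
  rw [reForm_mul_monomial hT0 hT hmul n (f := fun z => (starRingEnd ℂ) (f z))
    (continuous_conj.measurable.comp hf.measurable) (C := C') (R := R')
    (fun z => by simpa using hC' z) (fun z hz => by simp [hR' z hz])]
  exact hB.reForm_conj f (T n y) (T m x)

end monomials

section cutoff

variable {V : Type*} [NormedAddCommGroup V]

/-- A continuous function equal to `1` on the ball of radius `k` and to `0` off that of radius
`k + 1`. -/
def cutoff (k : ℕ) (z : V) : ℝ := max 0 (min 1 (k + 1 - ‖z‖))

lemma continuous_cutoff (k : ℕ) : Continuous (cutoff k : V → ℝ) := by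
  unfold cutoff
  fun_prop

lemma cutoff_nonneg (k : ℕ) (z : V) : 0 ≤ cutoff k z := le_max_left _ _

lemma cutoff_le_one (k : ℕ) (z : V) : cutoff k z ≤ 1 := max_le zero_le_one (min_le_left _ _)

lemma cutoff_eq_one {k : ℕ} {z : V} (h : ‖z‖ ≤ k) : cutoff k z = 1 := by
  unfold cutoff
  rw [min_eq_left (by linarith), max_eq_right zero_le_one]

lemma cutoff_eq_zero {k : ℕ} {z : V} (h : (k + 1 : ℝ) < ‖z‖) : cutoff k z = 0 := by
  unfold cutoff
  rw [max_eq_left]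
  exact (min_le_right _ _).trans (by linarith)

lemma hasCompactSupport_cutoff [ProperSpace V] (k : ℕ) :
    HasCompactSupport (cutoff k : V → ℝ) := by
  refine HasCompactSupport.intro (isCompact_closedBall 0 (k + 1 : ℝ)) fun z hz => ?_
  rw [mem_closedBall_zero_iff, not_le] at hz
  exact cutoff_eq_zero hz

lemma tendsto_cutoff (z : V) : Tendsto (fun k => cutoff k z) atTop (𝓝 1) := by
  obtain ⟨N, hN⟩ := exists_nat_ge ‖z‖
  refine tendsto_const_nhds.congr' ?_
  filter_upwards [eventually_ge_atTop N] with k hk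
  exact (cutoff_eq_one (hN.trans (by exact_mod_cast hk))).symm

end cutoff

section representation

variable {d : ℕ} {E : Type*} [AddCommGroup E] [Module ℂ E]
  {B : ((Fin d → ℂ) → ℝ) →ₗ[ℝ] (E →+ E →+ ℝ)}

lemma const_mem_domSubmodule (a : ℝ) :
    (fun _ => a : (Fin d → ℂ) → ℝ) ∈ domSubmodule (momentWeight (d := d)) :=
  ⟨measurable_const, |a|, fun z => le_mul_of_one_le_right (abs_nonneg a) (one_le_momentWeight z)⟩

lemma mem_domSubmodule_of_hasCompactSupport {f : (Fin d → ℂ) → ℝ} (hf : Continuous f)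
    (hfc : HasCompactSupport f) : f ∈ domSubmodule (momentWeight (d := d)) := by
  obtain ⟨C, hC⟩ := hfc.exists_bound_of_continuous hf
  exact mem_domSubmodule_of_abs_le hf.measurable (const_mem_domSubmodule C) hC

lemma one_sub_cutoff_le {k : ℕ} (hk : 0 < k) (z : Fin d → ℂ) :
    1 - cutoff k z ≤ (k : ℝ)⁻¹ * momentWeight z := by
  have hk' : (1 : ℝ) ≤ k := by exact_mod_cast hk
  rcases le_or_gt ‖z‖ k with h | h
  · rw [cutoff_eq_one h, sub_self]
    have := one_le_momentWeight z
    positivity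
  · have h1 := sq_norm_le_momentWeight z
    have h2 := cutoff_nonneg k z
    have h3 : 1 ≤ (k : ℝ)⁻¹ * momentWeight z := by
      rw [inv_mul_eq_div, le_div_iff₀ (by linarith)]
      nlinarith
    linarith

namespace IsPositiveForm

lemma tendsto_cutoff (hB : IsPositiveForm momentWeight B) (x y : E) :
    Tendsto (fun k => B (cutoff k) x y) atTop (𝓝 (B (fun _ => 1) x y)) := by
  have hW : momentWeight (d := d) ∈ domSubmodule momentWeight :=
    ⟨continuous_momentWeight.measurable, 1, fun z => by
      rw [one_mul, abs_of_nonneg (zero_le_one.trans (one_le_momentWeight z))]⟩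
  have hlim : Tendsto (fun k : ℕ => (k : ℝ)⁻¹ * ((B momentWeight x x + B momentWeight y y) / 2))
      atTop (𝓝 0) := by
    simpa using (tendsto_inv_atTop_nhds_zero_nat (𝕜 := ℝ)).mul_const
      ((B momentWeight x x + B momentWeight y y) / 2)
  rw [tendsto_iff_dist_tendsto_zero]
  refine squeeze_zero' (Eventually.of_forall fun _ => dist_nonneg) ?_ hlim
  filter_upwards [eventually_gt_atTop 0] with k hk
  have hle := hB.abs_le (h := cutoff k - fun _ => 1) (H := (k : ℝ)⁻¹ • momentWeight)
    (sub_mem (mem_domSubmodule_of_hasCompactSupport (continuous_cutoff k)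
      (hasCompactSupport_cutoff k)) (const_mem_domSubmodule 1)) (Submodule.smul_mem _ _ hW)
    (fun z => by
      rw [Pi.sub_apply, abs_sub_comm, abs_of_nonneg (sub_nonneg.2 (cutoff_le_one k z))]
      exact one_sub_cutoff_le hk z) x y
  rw [Real.dist_eq]
  rw [map_sub, map_smul] at hle
  simp only [AddMonoidHom.sub_apply, AddMonoidHom.smul_apply, smul_eq_mul] at hle
  refine hle.trans (le_of_eq ?_)
  ring

lemma exists_measure (hB : IsPositiveForm momentWeight B) (x : E) :
    ∃ ν : Measure (Fin d → ℂ), IsFiniteMeasureOnCompacts ν ∧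
      ∀ f : (Fin d → ℂ) → ℝ, Continuous f → HasCompactSupport f → ∫ z, f z ∂ν = B f x x := by
  let L : C_c(Fin d → ℂ, ℝ) →ₗ[ℝ] ℝ :=
    { toFun := fun f => B f x x
      map_add' := fun f g => by
        rw [CompactlySupportedContinuousMap.coe_add, map_add]
        rfl
      map_smul' := fun a f => by
        rw [CompactlySupportedContinuousMap.coe_smul, map_smul]
        rfl }
  let Λ : C_c(Fin d → ℂ, ℝ) →ₚ[ℝ] ℝ := PositiveLinearMap.mk₀ L fun f hf =>
    hB.nonneg f (mem_domSubmodule_of_hasCompactSupport f.continuous f.hasCompactSupport) hf x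
  exact ⟨RealRMK.rieszMeasure Λ, inferInstance, fun f hf hfc =>
    RealRMK.integral_rieszMeasure Λ ⟨⟨f, hf⟩, hfc⟩⟩

/-- A positive form for which multiplication by `z ^ e` acts as `T e` comes from a measure. -/
theorem exists_integral_cmom (hB : IsPositiveForm momentWeight B) {T : (Fin d → ℕ) → E → E}
    (hT0 : ∀ x, T 0 x = x) (hT : ∀ e e' x, T e (T e' x) = T (e + e') x)
    (hTI : ∀ e x, T e (I • x) = I • T e x)
    (hmul : ∀ i, ∀ f : (Fin d → ℂ) → ℂ, Measurable f → (∃ C, ∀ z, ‖f z‖ ≤ C) → ∀ x y,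
      reForm B (fun z => f z * z i) x y = reForm B f (T (Pi.single i 1) x) y) (x : E) :
    ∃ ν : Measure (Fin d → ℂ), ∀ m n : Fin d → ℕ, Integrable (fun z => cmom z m n) ν ∧
      (∫ z, cmom z m n ∂ν).re = B (fun _ => 1) (T m x) (T n x) ∧
      (∫ z, cmom z m n ∂ν).im = -B (fun _ => 1) (I • T m x) (T n x) := by
  obtain ⟨ν, hν, hintegral⟩ := hB.exists_measure x
  have hcut : ∀ (k : ℕ) m n (y y' : E),
      reForm B (fun z => (cutoff k z : ℂ) * cmom z m n) y y' = B (cutoff k) (T m y) (T n y') := by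
    intro k m n y y'
    rw [hB.reForm_mul_cmom hT0 hT hmul m n (f := fun z => (cutoff k z : ℂ))
      (continuous_ofReal.comp (continuous_cutoff k))
      ((hasCompactSupport_cutoff k).comp_left ofReal_zero)]
    simp only [reForm, ofReal_re, ofReal_im]
    rw [show (fun _ : Fin d → ℂ => (0 : ℝ)) = 0 from rfl, map_zero]
    simp
  have hre : ∀ (k : ℕ) m n, ∫ z, cutoff k z * (cmom z m n).re ∂ν
      = B (cutoff k) (T m x) (T n x) := by
    intro k m n
    rw [hintegral (fun z => cutoff k z * (cmom z m n).re)
      ((continuous_cutoff k).mul (continuous_re.comp (continuous_cmom m n)))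
      (hasCompactSupport_cutoff k).mul_right, ← hcut k m n]
    simp only [reForm, re_ofReal_mul, im_ofReal_mul]
    rw [hB.I_smul_self, add_zero]
  have him : ∀ (k : ℕ) m n, ∫ z, cutoff k z * (cmom z m n).im ∂ν
      = -B (cutoff k) (I • T m x) (T n x) := by
    intro k m n
    rw [hintegral (fun z => cutoff k z * (cmom z m n).im)
      ((continuous_cutoff k).mul (continuous_im.comp (continuous_cmom m n)))
      (hasCompactSupport_cutoff k).mul_right, ← hTI, ← hcut k m n]
    simp only [reForm, re_ofReal_mul, im_ofReal_mul]
    rw [hB.I_smul_self, zero_add, smul_smul, I_mul_I, neg_one_smul, map_neg,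
      AddMonoidHom.neg_apply, neg_neg]
  have hself : ∀ m, Integrable (fun z => cmom z m m) ν := by
    intro m
    have hn : ∀ z : Fin d → ℂ, ‖cmom z m m‖ = (cmom z m m).re := by
      intro z
      rw [cmom_self, ofReal_re, norm_real, Real.norm_of_nonneg (by positivity)]
    refine (aecover_closedBall (x := (0 : Fin d → ℂ))
      tendsto_natCast_atTop_atTop).integrable_of_integral_norm_bounded
      (B (fun _ => 1) (T m x) (T m x))
      (fun k => (continuous_cmom m m).continuousOn.integrableOn_compact (isCompact_closedBall _ _))
      (Eventually.of_forall fun k => ?_)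
    have hcont : Continuous fun z : Fin d → ℂ => cutoff k z * (cmom z m m).re :=
      (continuous_cutoff k).mul (continuous_re.comp (continuous_cmom m m))
    have hci : Integrable (fun z : Fin d → ℂ => cutoff k z * (cmom z m m).re) ν :=
      hcont.integrable_of_hasCompactSupport (hasCompactSupport_cutoff k).mul_right
    calc ∫ z in Metric.closedBall 0 (k : ℝ), ‖cmom z m m‖ ∂ν
        = ∫ z in Metric.closedBall 0 (k : ℝ), cutoff k z * (cmom z m m).re ∂ν := by
          refine setIntegral_congr_fun Metric.isClosed_closedBall.measurableSet fun z hz => ?_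
          rw [mem_closedBall_zero_iff] at hz
          simp only [hn, cutoff_eq_one hz, one_mul]
      _ ≤ ∫ z, cutoff k z * (cmom z m m).re ∂ν := by
          refine setIntegral_le_integral hci (Eventually.of_forall fun z => ?_)
          exact mul_nonneg (cutoff_nonneg k z) (hn z ▸ norm_nonneg _)
      _ = B (cutoff k) (T m x) (T m x) := hre k m m
      _ ≤ B (fun _ => 1) (T m x) (T m x) :=
          hB.mono (mem_domSubmodule_of_hasCompactSupport (continuous_cutoff k)
            (hasCompactSupport_cutoff k)) (const_mem_domSubmodule 1) (cutoff_le_one k) _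
  have hI : ∀ m n, Integrable (fun z => cmom z m n) ν := fun m n =>
    ((hself m).norm.add (hself n).norm).mono' (continuous_cmom m n).aestronglyMeasurable
      (Eventually.of_forall fun z => norm_cmom_le z m n)
  have hlim : ∀ g : (Fin d → ℂ) → ℝ, Integrable g ν →
      Tendsto (fun k => ∫ z, cutoff k z * g z ∂ν) atTop (𝓝 (∫ z, g z ∂ν)) := by
    intro g hg
    refine tendsto_integral_of_dominated_convergence (fun z => ‖g z‖)
      (fun k => (continuous_cutoff k).aestronglyMeasurable.mul hg.aestronglyMeasurable) hg.norm
      (fun k => Eventually.of_forall fun z => ?_) (Eventually.of_forall fun z => ?_)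
    · rw [norm_mul, Real.norm_of_nonneg (cutoff_nonneg k z)]
      exact mul_le_of_le_one_left (norm_nonneg _) (cutoff_le_one k z)
    · simpa using (_root_.tendsto_cutoff z).mul_const (g z)
  refine ⟨ν, fun m n => ⟨hI m n, ?_, ?_⟩⟩
  · have h1 := hlim _ (hI m n).re
    have h2 : ∫ z, (cmom z m n).re ∂ν = (∫ z, cmom z m n ∂ν).re := integral_re (hI m n)
    rw [← h2]
    refine tendsto_nhds_unique h1 ?_
    exact (hB.tendsto_cutoff (T m x) (T n x)).congr fun k => (hre k m n).symm
  · have h1 := hlim _ (hI m n).im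
    have h2 : ∫ z, (cmom z m n).im ∂ν = (∫ z, cmom z m n ∂ν).im := integral_im (hI m n)
    rw [← h2]
    refine tendsto_nhds_unique h1 ?_
    exact (hB.tendsto_cutoff (I • T m x) (T n x)).neg.congr fun k => (him k m n).symm

end IsPositiveForm

end representation

section truncated

variable {d : ℕ} {c : (Fin d → ℕ) → (Fin d → ℕ) → ℂ}

/-- If the moments of order at most one in each variable have the prescribed values, then the form
represents `c`. -/
lemma IsPositiveForm.exists_integral_eq {B : ((Fin d → ℂ) → ℝ) →ₗ[ℝ]
      (((Fin d → ℕ) →₀ ℂ) →+ ((Fin d → ℕ) →₀ ℂ) →+ ℝ)} (hB : IsPositiveForm momentWeight B)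
    (hreal : ∀ ξ, (sesq c 0 0 ξ ξ).im = 0)
    (hone : ∀ ξ η, B (fun _ => 1) ξ η = ((sesq c 0 0 ξ η).re + (sesq c 0 0 η ξ).re) / 2)
    (hsq : ∀ i ξ, B (fun z => ‖z i‖ ^ 2) ξ ξ
      = (sesq c (Pi.single i 1) (Pi.single i 1) ξ ξ).re)
    (hre : ∀ i ξ η, B (fun z => (z i).re) ξ η
      = ((sesq c (Pi.single i 1) 0 ξ η).re + (sesq c (Pi.single i 1) 0 η ξ).re) / 2)
    (him : ∀ i ξ η, B (fun z => (z i).im) ξ η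
      = ((sesq c (Pi.single i 1) 0 ξ η).im + (sesq c (Pi.single i 1) 0 η ξ).im) / 2) :
    ∃ ν : Measure (Fin d → ℂ), ∀ m n : Fin d → ℕ,
      Integrable (fun z => cmom z m n) ν ∧ c m n = ∫ z, cmom z m n ∂ν := by
  have hone' : ∀ ξ η, B (fun _ => 1) ξ η = (sesq c 0 0 ξ η).re := fun ξ η => by
    rw [hone, sesq_re_comm 0 0 hreal]
    ring
  have hlin : ∀ i ξ η, reForm B (fun z => z i) ξ η
      = (sesq c 0 0 (shift (Pi.single i 1) ξ) η).re := by
    intro i ξ η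
    rw [sesq_shift_left, zero_add, reForm, hre, him, sesq_smul_left, sesq_smul_right]
    simp
    ring
  obtain ⟨ν, hν⟩ := hB.exists_integral_cmom (T := shift) shift_zero shift_shift
    (fun e ξ => shift_smul e I ξ)
    (fun i f hf ⟨C, hC⟩ ξ η => hB.reForm_mul continuous_momentWeight.measurable
      one_le_momentWeight (measurable_pi_apply i) (sq_norm_apply_le_momentWeight i)
      (fun ξ => shift_smul _ I ξ) (fun ξ => by
        rw [hlin, hsq, hone', sesq_shift_right, sesq_shift_left, zero_add]
        ring) hf hC ξ η) (Finsupp.single 0 1)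
  refine ⟨ν, fun m n => ⟨(hν m n).1, Complex.ext ?_ ?_⟩⟩
  · rw [(hν m n).2.1, hone', sesq_shift_right, sesq_shift_left, zero_add, zero_add, sesq_single]
  · rw [(hν m n).2.2, hone', sesq_smul_left, sesq_shift_right, sesq_shift_left, zero_add, zero_add,
      sesq_single]
    simp

end truncated

end auxiliary

/-- If a family of positive Borel measures on `ℂ^d` solves the truncations `m, n ∈ N₁` of
`(c_{m,n})` and satisfies `μ_0 = 0`, `μ_{ξ+η} + μ_{ξ-η} - 2μ_η ≥ 0`, then `(c_{m,n})` is a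
complex moment multisequence. -/
theorem complexMoment_of_truncated_family (d : ℕ) (hd : 1 ≤ d)
    (c : (Fin d → ℕ) → (Fin d → ℕ) → ℂ)
    (μ : ((Fin d → ℕ) →₀ ℂ) → Measure (Fin d → ℂ))
    (hmom : ∀ ξ : (Fin d → ℕ) →₀ ℂ, ∀ m n : Fin d → ℕ, (∑ i, m i ≤ 1) → (∑ i, n i ≤ 1) →
        Integrable (fun z => cmom z m n) (μ ξ) ∧ cXi c ξ m n = ∫ z, cmom z m n ∂(μ ξ))
    (h0 : μ 0 = 0)
    (hpos : ∀ ξ η : (Fin d → ℕ) →₀ ℂ, ∀ σ : Set (Fin d → ℂ), MeasurableSet σ →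
        2 * μ η σ ≤ μ (ξ + η) σ + μ (ξ - η) σ) :
    ∃ ν : Measure (Fin d → ℂ), ∀ m n : Fin d → ℕ,
        Integrable (fun z => cmom z m n) ν ∧ c m n = ∫ z, cmom z m n ∂ν := by
  have hs0 : ∑ i, (0 : Fin d → ℕ) i ≤ 1 := by simp
  have hs1 : ∀ i : Fin d, ∑ j, (Pi.single i 1 : Fin d → ℕ) j ≤ 1 := fun i => by simp
  have hint0 : ∀ ξ, Integrable (fun _ : Fin d → ℂ => (1 : ℂ)) (μ ξ) := fun ξ => by
    simpa only [cmom_zero_zero] using (hmom ξ 0 0 hs0 hs0).1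
  have hval0 : ∀ ξ, sesq c 0 0 ξ ξ = ∫ _, (1 : ℂ) ∂μ ξ := fun ξ => by
    simpa only [cmom_zero_zero, cXi_eq_sesq] using (hmom ξ 0 0 hs0 hs0).2
  have hint1 : ∀ i ξ, Integrable (fun z : Fin d → ℂ => z i) (μ ξ) := fun i ξ => by
    simpa only [cmom_single_zero] using (hmom ξ _ 0 (hs1 i) hs0).1
  have hval1 : ∀ i ξ, sesq c (Pi.single i 1) 0 ξ ξ = ∫ z, z i ∂μ ξ := fun i ξ => by
    simpa only [cmom_single_zero, cXi_eq_sesq] using (hmom ξ _ 0 (hs1 i) hs0).2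
  have hint2 : ∀ i ξ, Integrable (fun z : Fin d → ℂ => ‖z i‖ ^ 2) (μ ξ) := fun i ξ => by
    have := (hmom ξ _ _ (hs1 i) (hs1 i)).1.re
    simpa only [cmom_single_single, RCLike.re_to_complex, ofReal_re] using this
  have hval2 : ∀ i ξ, sesq c (Pi.single i 1) (Pi.single i 1) ξ ξ
      = ((∫ z, ‖z i‖ ^ 2 ∂μ ξ : ℝ) : ℂ) := fun i ξ => by
    have := (hmom ξ _ _ (hs1 i) (hs1 i)).2
    simp only [cmom_single_single, cXi_eq_sesq] at this
    rw [this]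
    exact integral_ofReal
  have hfin : ∀ ξ, IsFiniteMeasure (μ ξ) := fun ξ =>
    (integrable_const_iff.1 (hint0 ξ)).resolve_left one_ne_zero
  have hreal : ∀ ξ, sesq c 0 0 ξ ξ = ((∫ _, (1 : ℝ) ∂μ ξ : ℝ) : ℂ) := fun ξ => by
    rw [hval0]
    simp
  have hweight : ∀ ξ, ∫ z, momentWeight z ∂μ ξ = (sesq c 0 0 ξ ξ).re
      + ∑ i, (sesq c (Pi.single i 1) (Pi.single i 1) ξ ξ).re := by
    intro ξ
    unfold momentWeight
    rw [integral_add (integrable_const 1) (integrable_finsetSum _ fun i _ => hint2 i ξ),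
      integral_finsetSum _ fun i _ => hint2 i ξ, hreal, ofReal_re]
    simp only [hval2, ofReal_re]
  have hquad : (fun ξ => (sesq c 0 0 ξ ξ).re
      + ∑ i, (sesq c (Pi.single i 1) (Pi.single i 1) ξ ξ).re)
      ∈ quadSubmodule ((Fin d → ℕ) →₀ ℂ) := by
    have := add_mem (re_sesq_mem_quadSubmodule (c := c) 0 0) (sum_mem (t := Finset.univ)
      fun i _ => re_sesq_mem_quadSubmodule (c := c) (Pi.single i 1) (Pi.single i 1))
    convert this using 1
    ext ξ
    simp
  obtain ⟨Q, hQ, hQeq⟩ := exists_quadratic_average (μ := μ) (w := momentWeight) hpos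
    continuous_momentWeight.measurable (fun z => zero_le_one.trans (one_le_momentWeight z))
    (fun ξ => (integrable_const 1).add (integrable_finsetSum _ fun i _ => hint2 i ξ))
    hquad hweight
  have hle : ∀ (i : Fin d) (z : Fin d → ℂ), ‖z i‖ ≤ 1 * momentWeight z := fun i z => by
    have h1 := one_le_momentWeight z
    have h2 := sq_norm_apply_le_momentWeight i z
    nlinarith [norm_nonneg (z i)]
  refine (isPositiveForm_polarForm Q hQ).exists_integral_eq (c := c) (fun ξ => by
    rw [hreal, ofReal_im]) ?_ ?_ ?_ ?_
  · refine polarForm_re_sesq 0 0 (hQeq _ (const_mem_domSubmodule 1) _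
      (re_sesq_mem_quadSubmodule 0 0) fun ξ => ?_)
    rw [hreal, ofReal_re]
  · intro i ξ
    rw [LinearMap.comp_apply, polarForm_self, hQeq _ ⟨by fun_prop, 1, fun z => ?_⟩ _
      (re_sesq_mem_quadSubmodule (c := c) (Pi.single i 1) (Pi.single i 1)) fun ξ => ?_]
    · rw [abs_of_nonneg (by positivity), one_mul]
      exact sq_norm_apply_le_momentWeight i z
    · rw [hval2, ofReal_re]
  · intro i
    refine polarForm_re_sesq _ 0 (hQeq _ ⟨by fun_prop, 1, fun z =>
      (abs_re_le_norm _).trans (hle i z)⟩ _ (re_sesq_mem_quadSubmodule _ 0) fun ξ => ?_)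
    rw [hval1]
    exact integral_re (hint1 i ξ)
  · intro i
    refine polarForm_im_sesq _ 0 (hQeq _ ⟨by fun_prop, 1, fun z =>
      (abs_im_le_norm _).trans (hle i z)⟩ _ (im_sesq_mem_quadSubmodule _ 0) fun ξ => ?_)
    rw [hval1]
    exact integral_im (hint1 i ξ)
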